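/- arXiv:1403.5962 — 3 statements merged into one kernel-verified Lean document; each statement's English description precedes it below -/
import Mathlib

section
/- The number of metasylvester classes of words of packed evaluation (i_1, ..., i_r) equals (1+i_r)(1+i_{r-1}+i_r)···(1+i_2+···+i_r). -/
/-- One elementary metasylvester rewriting. -/
def MetaStep {α : Type*} [LinearOrder α] (w w' : List α) : Prop :=
  (∃ (u v x : List α) (a b : α), a < b ∧
      w = u ++ [a, b] ++ v ++ [a] ++ x ∧ w' = u ++ [b, a] ++ v ++ [a] ++ x) ∨
  (∃ (u v y x : List α) (a b c : α), a < b ∧ b < c ∧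
      w = u ++ [b] ++ v ++ [a, c] ++ y ++ [b] ++ x ∧
      w' = u ++ [b] ++ v ++ [c, a] ++ y ++ [b] ++ x)

namespace Sylv

open Classical in
/-- Number of bad letters met while scanning the word with active set `A`. -/
noncomputable def H {α : Type*} [LinearOrder α] : Set α → List α → ℕ
  | _, [] => 0
  | A, c :: v => if ∃ b ∈ A, b < c ∧ b ∈ v then 1 + H (insert c A) v else H A v

def Avoid {α : Type*} [LinearOrder α] (w : List α) : Prop :=
  ∀ b c, b < c → ¬ [b, c, b].Sublist w

section
variable {α : Type*} [LinearOrder α]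

theorem H_pos (A : Set α) (c : α) (v : List α) (h : ∃ b ∈ A, b < c ∧ b ∈ v) :
    H A (c :: v) = 1 + H (insert c A) v := by
  rw [H, if_pos h]

theorem H_neg (A : Set α) (c : α) (v : List α) (h : ¬ ∃ b ∈ A, b < c ∧ b ∈ v) :
    H A (c :: v) = H A v := by
  rw [H, if_neg h]

theorem H_congr_cons (A : Set α) (c : α) (v v' : List α) (hm : ∀ b, b ∈ v ↔ b ∈ v')
    (h : ∀ B, H B v = H B v') : H A (c :: v) = H A (c :: v') := by
  by_cases hc : ∃ b ∈ A, b < c ∧ b ∈ v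
  · have hc' : ∃ b ∈ A, b < c ∧ b ∈ v' := by simpa only [hm] using hc
    rw [H_pos _ _ _ hc, H_pos _ _ _ hc', h]
  · have hc' : ¬ ∃ b ∈ A, b < c ∧ b ∈ v' := by simpa only [hm] using hc
    rw [H_neg _ _ _ hc, H_neg _ _ _ hc', h]

/-- key swap lemma: if the badness of `z` is unaffected by `x`. -/
theorem H_swap (A : Set α) (x z : α) (v : List α) (hxz : x < z)
    (h1 : (∃ b ∈ A, b < z ∧ b ∈ x :: v) → ∃ b ∈ A, b < z ∧ b ∈ v)
    (h3 : (∃ b ∈ A, b < x ∧ b ∈ v) → ∃ b ∈ A, b < z ∧ b ∈ v) :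
    H A (x :: z :: v) = H A (z :: x :: v) := by
  by_cases hx : ∃ b ∈ A, b < x ∧ b ∈ v
  · have hz := h3 hx
    rw [H_pos A x (z :: v) (by obtain ⟨b, h⟩ := hx; exact ⟨b, by simp [h]⟩),
      H_pos (insert x A) z v (by obtain ⟨b, h⟩ := hz; exact ⟨b, by simp [h]⟩),
      H_pos A z (x :: v) (by obtain ⟨b, h⟩ := hz; exact ⟨b, by simp [h]⟩),
      H_pos (insert z A) x v (by obtain ⟨b, h⟩ := hx; exact ⟨b, by simp [h]⟩),
      Set.insert_comm]
  · have hx1 : ¬ ∃ b ∈ A, b < x ∧ b ∈ z :: v := by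
      rintro ⟨b, hb, hbx, hm⟩
      rcases List.mem_cons.1 hm with rfl | hm
      · exact absurd hbx (not_lt.2 hxz.le)
      · exact hx ⟨b, hb, hbx, hm⟩
    have hx2 : ¬ ∃ b ∈ insert z A, b < x ∧ b ∈ v := by
      rintro ⟨b, hb, hbx, hm⟩
      rcases hb with rfl | hb
      · exact absurd hbx (not_lt.2 hxz.le)
      · exact hx ⟨b, hb, hbx, hm⟩
    rw [H_neg A x _ hx1]
    by_cases hz : ∃ b ∈ A, b < z ∧ b ∈ v
    · rw [H_pos A z v hz, H_pos A z (x :: v)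
        (by obtain ⟨b, h⟩ := hz; exact ⟨b, by simp [h]⟩), H_neg _ x v hx2]
    · rw [H_neg A z v hz, H_neg A z (x :: v) (fun h => hz (h1 h)), H_neg _ x v hx]

theorem H_rule1 (x y : α) (hxy : x < y) (v : List α) (hv : x ∈ v) (p : List α) :
    ∀ A : Set α, H A (p ++ x :: y :: v) = H A (p ++ y :: x :: v) := by
  induction p with
  | nil =>
    intro A
    have h3 : (∃ b ∈ A, b < x ∧ b ∈ v) → ∃ b ∈ A, b < y ∧ b ∈ v := by
      rintro ⟨b, h, h', h''⟩; exact ⟨b, h, h'.trans hxy, h''⟩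
    refine H_swap A x y v hxy ?_ h3
    rintro ⟨b, h, h', h''⟩
    refine ⟨b, h, h', ?_⟩
    rcases List.mem_cons.1 h'' with rfl | h''
    · exact hv
    · exact h''
  | cons c p ih =>
    intro A
    simp only [List.cons_append]
    apply H_congr_cons _ _ _ _ _ ih
    intro b; simp only [List.mem_append, List.mem_cons]; tauto

theorem H_rule2_aux (x b z : α) (hxb : x < b) (hbz : b < z) (v : List α) (hv : b ∈ v)
    (p : List α) : ∀ A : Set α,
    (b ∈ A ∨ ∀ b' ∈ A, b' < b → b' ∉ p ++ x :: z :: v) →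
    H A (p ++ x :: z :: v) = H A (p ++ z :: x :: v) := by
  induction p with
  | nil =>
    intro A hA
    have h3 : (∃ b ∈ A, b < x ∧ b ∈ v) → ∃ b ∈ A, b < z ∧ b ∈ v := by
      rintro ⟨b, h, h', h''⟩; exact ⟨b, h, h'.trans (hxb.trans hbz), h''⟩
    refine H_swap A x z v (hxb.trans hbz) ?_ h3
    rintro ⟨d, h, h', h''⟩
    rcases hA with hA | hA
    · exact ⟨b, hA, hbz, hv⟩
    · refine ⟨d, h, h', ?_⟩
      rcases List.mem_cons.1 h'' with rfl | h''
      · exact absurd (by simp) (hA d h hxb)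
      · exact h''
  | cons c p ih =>
    intro A hA
    have hm : ∀ d, d ∈ p ++ x :: z :: v ↔ d ∈ p ++ z :: x :: v := by
      intro b; simp only [List.mem_append, List.mem_cons]; tauto
    simp only [List.cons_append] at hA ⊢
    by_cases hc : ∃ d ∈ A, d < c ∧ d ∈ p ++ x :: z :: v
    · have hc' : ∃ d ∈ A, d < c ∧ d ∈ p ++ z :: x :: v := by simpa only [hm] using hc
      rw [H_pos _ _ _ hc, H_pos _ _ _ hc', ih]
      rcases hA with hA | hA
      · exact Or.inl (Or.inr hA)
      · right
        rintro d (rfl | hd) hdb hmem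
        · obtain ⟨e, he, hed, hem⟩ := hc
          exact hA e he (hed.trans hdb) (List.mem_cons_of_mem _ hem)
        · exact hA d hd hdb (List.mem_cons_of_mem _ hmem)
    · have hc' : ¬ ∃ d ∈ A, d < c ∧ d ∈ p ++ z :: x :: v := by simpa only [hm] using hc
      rw [H_neg _ _ _ hc, H_neg _ _ _ hc', ih]
      rcases hA with hA | hA
      · exact Or.inl hA
      · exact Or.inr fun d hd hdb hmem => hA d hd hdb (List.mem_cons_of_mem _ hmem)

theorem H_rule2 (x b z : α) (hxb : x < b) (hbz : b < z) (v : List α) (hv : b ∈ v)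
    (p u : List α) : ∀ A : Set α,
    H A (u ++ b :: (p ++ x :: z :: v)) = H A (u ++ b :: (p ++ z :: x :: v)) := by
  have hm : ∀ d, d ∈ p ++ x :: z :: v ↔ d ∈ p ++ z :: x :: v := by
    intro b; simp only [List.mem_append, List.mem_cons]; tauto
  induction u with
  | nil =>
    intro A
    simp only [List.nil_append]
    by_cases hc : ∃ d ∈ A, d < b ∧ d ∈ p ++ x :: z :: v
    · have hc' : ∃ d ∈ A, d < b ∧ d ∈ p ++ z :: x :: v := by simpa only [hm] using hc
      rw [H_pos _ _ _ hc, H_pos _ _ _ hc', H_rule2_aux x b z hxb hbz v hv]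
      exact Or.inl (Or.inl rfl)
    · have hc' : ¬ ∃ d ∈ A, d < b ∧ d ∈ p ++ z :: x :: v := by simpa only [hm] using hc
      rw [H_neg _ _ _ hc, H_neg _ _ _ hc', H_rule2_aux x b z hxb hbz v hv]
      exact Or.inr fun d hd hdb hmem => hc ⟨d, hd, hdb, hmem⟩
  | cons c u ih =>
    intro A
    simp only [List.cons_append]
    apply H_congr_cons _ _ _ _ _ ih
    intro b; simp only [List.mem_append, List.mem_cons]; tauto

theorem H_step (A : Set α) (w w' : List α) (h : MetaStep w w') : H A w = H A w' := by
  rcases h with ⟨u, v, x, a, b, hab, rfl, rfl⟩ | ⟨u, v, y, x, a, b, c, hab, hbc, rfl, rfl⟩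
  · have := H_rule1 a b hab (v ++ a :: x) (by simp) u A
    simpa using this
  · have := H_rule2 a b c hab hbc (y ++ b :: x) (by simp) v u A
    simpa using this

theorem H_eqv (A : Set α) (w w' : List α) (h : Relation.EqvGen MetaStep w w') :
    H A w = H A w' := by
  induction h with
  | rel _ _ h => exact H_step A _ _ h
  | refl => rfl
  | symm _ _ _ ih => exact ih.symm
  | trans _ _ _ _ _ ih1 ih2 => exact ih1.trans ih2

theorem H_zero (s : List α) : ∀ A : Set α,
    (∀ b ∈ A, ∀ c, b < c → ¬ [c, b].Sublist s) → H A s = 0 := by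
  induction s with
  | nil => intro A _; rfl
  | cons c s ih =>
    intro A hA
    rw [H_neg, ih]
    · exact fun b hb d hbd hs => hA b hb d hbd (hs.cons _)
    · rintro ⟨b, hb, hbc, hm⟩
      exact hA b hb c hbc (List.Sublist.cons_cons _ (List.singleton_sublist.2 hm))

theorem H_lower (x : α) (v : List α) (hx : x ∈ v) (q : List α) : ∀ A : Set α, x ∈ A →
    q.countP (fun d => x < d) ≤ H A (q ++ v) := by
  induction q with
  | nil => intro A _; simp
  | cons c q ih =>
    intro A hA
    simp only [List.cons_append]
    by_cases hc : x < c
    · rw [H_pos _ _ _ ⟨x, hA, hc, by simp [hx]⟩, List.countP_cons_of_pos (by simpa using hc)]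
      have := ih (insert c A) (Or.inr hA)
      omega
    · rw [List.countP_cons_of_neg (by simpa using hc)]
      by_cases h : ∃ b ∈ A, b < c ∧ b ∈ q ++ v
      · rw [H_pos _ _ _ h]
        have := ih (insert c A) (Or.inr hA)
        omega
      · rw [H_neg _ _ _ h]
        exact ih A hA

theorem H_upper (x : α) (v : List α) (q : List α) : ∀ A : Set α, (∀ a ∈ A, x ≤ a) →
    (∀ B : Set α, (∀ b ∈ B, b ∈ A ∨ b ∈ q) → H B v = 0) →
    H A (q ++ v) ≤ q.countP (fun d => x < d) := by
  induction q with
  | nil => intro A _ h; simp [h A (fun b hb => Or.inl hb)]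
  | cons c q ih =>
    intro A hA h
    simp only [List.cons_append]
    by_cases hc : ∃ b ∈ A, b < c ∧ b ∈ q ++ v
    · have hxc : x < c := by
        obtain ⟨b, hb, hbc, _⟩ := hc
        exact (hA b hb).trans_lt hbc
      rw [H_pos _ _ _ hc, List.countP_cons_of_pos (by simpa using hxc)]
      have := ih (insert c A) (by rintro a (rfl | ha); exacts [hxc.le, hA a ha]) (by
        intro B hB
        apply h B
        intro b hb
        rcases hB b hb with (rfl | h) | h
        · simp
        · simp [h]
        · simp [h])
      omega
    · rw [H_neg _ _ _ hc]
      refine (ih A hA ?_).trans ?_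
      · intro B hB
        apply h B
        intro b hb
        rcases hB b hb with h | h
        · simp [h]
        · simp [h]
      · rw [List.countP_cons]; omega

theorem avoid_lt_false (p s t : List α) (x y : α) (hxy : x < y)
    (hw : Avoid (p ++ x :: s)) (hc : (p ++ x :: s).count x = (p ++ y :: t).count x)
    (hH : H {x} (p ++ x :: s) = H {x} (p ++ y :: t)) : False := by
  have hxt : x ∈ t := by
    rw [← List.count_pos_iff]
    simp only [List.count_append, List.count_cons_self, List.count_cons_of_ne hxy.ne'] at hc
    omega
  have h1 := H_lower x t hxt (p ++ [y]) {x} rfl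
  rw [List.countP_append, List.countP_singleton] at h1
  have h2 := H_upper x (x :: s) p {x} (by simp) (by
    intro B hB
    apply H_zero
    intro b hb c hbc hs
    refine hw b c hbc ?_
    rcases hB b hb with h | h
    · obtain rfl : b = x := h
      have : [c, b].Sublist s := by
        rcases List.sublist_cons_iff.1 hs with h | ⟨r, h, _⟩
        · exact h
        · simp only [List.cons.injEq] at h; exact absurd h.1 hbc.ne'
      exact (this.cons_cons b).trans (List.sublist_append_right _ _)
    · exact (List.singleton_sublist.2 h).append hs)
  simp [hxy] at h1
  rw [hH] at h2
  omega

theorem avoid_unique (w : List α) : ∀ (w' p : List α),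
    Avoid (p ++ w) → Avoid (p ++ w') → (∀ a, (p ++ w).count a = (p ++ w').count a) →
    (∀ a, H {a} (p ++ w) = H {a} (p ++ w')) → w = w' := by
  induction w with
  | nil =>
    intro w' p _ _ hc _
    cases w' with
    | nil => rfl
    | cons y t => have := hc y; simp at this
  | cons x s ih =>
    intro w' p h1 h2 hc hH
    cases w' with
    | nil => have := hc x; simp at this
    | cons y t =>
      rcases lt_trichotomy x y with h | rfl | h
      · exact (avoid_lt_false p s t x y h h1 (hc x) (hH x)).elim
      · rw [ih t (p ++ [x])] <;> simpa only [List.append_assoc, List.singleton_append]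
      · exact (avoid_lt_false p t s y x h h2 (hc y).symm (hH y).symm).elim

theorem step_perm (w w' : List α) (h : MetaStep w w') : w.Perm w' := by
  rcases h with ⟨u, v, x, a, b, hab, rfl, rfl⟩ | ⟨u, v, y, x, a, b, c, hab, hbc, rfl, rfl⟩
  · simp only [List.append_assoc, List.cons_append, List.nil_append]
    exact (List.Perm.swap _ _ _).append_left _
  · simp only [List.append_assoc, List.cons_append, List.nil_append]
    exact (((List.Perm.swap _ _ _).append_left _).cons _).append_left _

theorem swap_lt (u s : List α) (a b : α) (h : a < b) :
    u ++ a :: b :: s < u ++ b :: a :: s := by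
  induction u with
  | nil => exact List.Lex.rel h
  | cons c u ih => exact List.Lex.cons ih

theorem exists_step (p : List α) (b : α) (q : List α) : ∀ (c : α) (s : List α), b < c → b ∈ s →
    ∃ w', MetaStep (p ++ b :: (q ++ c :: s)) w' ∧ (p ++ b :: (q ++ c :: s)) < w' := by
  induction q using List.reverseRecOn with
  | nil =>
    intro c s hbc hs
    obtain ⟨v, x, rfl⟩ := List.append_of_mem hs
    refine ⟨p ++ c :: b :: (v ++ b :: x), Or.inl ⟨p, v, x, b, c, hbc, by simp, by simp⟩, ?_⟩
    exact swap_lt _ _ _ _ hbc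
  | append_singleton q d ih =>
    intro c s hbc hs
    rcases lt_trichotomy d b with h | rfl | h
    · obtain ⟨v, x, rfl⟩ := List.append_of_mem hs
      refine ⟨(p ++ b :: q) ++ c :: d :: (v ++ b :: x),
        Or.inr ⟨p, q, v, x, d, b, c, h, hbc, by simp, by simp⟩, ?_⟩
      have := swap_lt (p ++ b :: q) (v ++ b :: x) d c (h.trans hbc)
      simpa using this
    · obtain ⟨v, x, rfl⟩ := List.append_of_mem hs
      refine ⟨(p ++ d :: q) ++ c :: d :: (v ++ d :: x),
        Or.inl ⟨p ++ d :: q, v, x, d, c, hbc, by simp, by simp⟩, ?_⟩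
      have := swap_lt (p ++ d :: q) (v ++ d :: x) d c hbc
      simpa using this
    · have := ih d (c :: s) h (by simp [hs])
      simpa using this

theorem exists_step_of_not_avoid (w : List α) (h : ¬ Avoid w) :
    ∃ w', MetaStep w w' ∧ w < w' := by
  simp only [Avoid, not_forall, not_not] at h
  obtain ⟨b, c, hbc, hs⟩ := h
  obtain ⟨p, r', rfl, hp, hs2⟩ := List.cons_sublist_iff.1 hs
  obtain ⟨q, r, rfl, hq, hs3⟩ := List.cons_sublist_iff.1 hs2
  obtain ⟨p1, p2, rfl⟩ := List.append_of_mem hp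
  obtain ⟨q1, q2, rfl⟩ := List.append_of_mem hq
  have := exists_step p1 b (p2 ++ q1) c (q2 ++ r) hbc
    (List.mem_append_right _ (List.singleton_sublist.1 hs3))
  simpa using this

theorem eqv_perm (w w' : List α) (h : Relation.EqvGen MetaStep w w') : w.Perm w' := by
  induction h with
  | rel _ _ h => exact step_perm _ _ h
  | refl => rfl
  | symm _ _ _ ih => exact ih.symm
  | trans _ _ _ _ _ ih1 ih2 => exact ih1.trans ih2

theorem exists_avoid (w : List α) : ∃ w', Relation.EqvGen MetaStep w w' ∧ Avoid w' := by
  have hfin : {w' | Relation.EqvGen MetaStep w w'}.Finite :=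
    (List.finite_toSet w.permutations).subset fun w' h =>
      List.mem_permutations.2 (eqv_perm _ _ h).symm
  obtain ⟨m, hm⟩ := hfin.exists_maximal ⟨w, Relation.EqvGen.refl w⟩
  refine ⟨m, hm.1, ?_⟩
  by_contra hna
  obtain ⟨m', hs, hlt⟩ := exists_step_of_not_avoid m hna
  exact hm.not_gt (Relation.EqvGen.trans _ _ _ hm.1 (Relation.EqvGen.rel _ _ hs)) hlt

end

theorem avoid_insert {r : ℕ} (m : ℕ) (u v : List (Fin r)) (h : Avoid (u ++ v)) :
    Avoid (u.map Fin.succ ++ (List.replicate m 0 ++ v.map Fin.succ)) := by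
  intro b c hbc hs
  rcases Fin.eq_zero_or_eq_succ b with rfl | ⟨b, rfl⟩
  · have hc : c ≠ 0 := hbc.ne'
    obtain ⟨l1, l2, he, h1, h2⟩ := List.sublist_append_iff.1 hs
    obtain ⟨l3, l4, rfl, h3, h4⟩ := List.sublist_append_iff.1 h2
    have n1 : (0 : Fin (r+1)) ∉ l1 := fun h => by simpa using h1.subset h
    have n3 : c ∉ l3 := fun h => by
      have := h3.subset h
      simp [hc] at this
    have n4 : (0 : Fin (r+1)) ∉ l4 := fun h => by simpa using h4.subset h
    clear hs h1 h2 h3 h4 h hbc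
    cases l1 with
    | cons d l1 => simp at he; simp [he.1] at n1
    | nil =>
      cases l3 with
      | nil => simp at he; simp [← he] at n4
      | cons d l3 =>
        cases l3 with
        | nil => simp at he; simp [← he.2] at n4
        | cons e l3 => simp at he; simp [he.2.1] at n3
  · obtain ⟨c, rfl⟩ := Fin.exists_succ_eq.2 (show c ≠ 0 from (lt_of_le_of_lt (Fin.zero_le _) hbc).ne')
    have hf := hs.filter (fun d => d ≠ 0)
    refine h b c (Fin.succ_lt_succ_iff.1 hbc) ?_
    have e : (u.map Fin.succ ++ (List.replicate m 0 ++ v.map Fin.succ)).filter (fun d => d ≠ 0)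
        = (u ++ v).map Fin.succ := by
      have hl : ∀ l : List (Fin r), (l.map Fin.succ).filter (fun d => d ≠ 0) = l.map Fin.succ := by
        intro l
        rw [List.filter_eq_self]
        simp
      rw [List.filter_append, List.filter_append, hl, hl, List.map_append]
      simp
    rw [e] at hf
    have hf' : ([b, c, b].map Fin.succ).Sublist ((u ++ v).map Fin.succ) := by simpa using hf
    obtain ⟨l, hl, he⟩ := List.sublist_map_iff.1 hf'
    rw [List.map_injective_iff.2 (Fin.succ_injective r) he]
    exact hl

theorem avoid_decomp {r : ℕ} (w : List (Fin (r+1))) (h : Avoid w) (h0 : 1 ≤ w.count 0) :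
    ∃ u v : List (Fin r), w = u.map Fin.succ ++ (List.replicate (w.count 0) 0 ++ v.map Fin.succ) := by
  have lift : ∀ l : List (Fin (r+1)), 0 ∉ l → ∃ l' : List (Fin r), l = l'.map Fin.succ := by
    intro l
    induction l with
    | nil => intro _; exact ⟨[], rfl⟩
    | cons c l ih =>
      intro hl
      simp only [List.mem_cons, not_or] at hl
      obtain ⟨l', rfl⟩ := ih hl.2
      obtain ⟨c', rfl⟩ := Fin.exists_succ_eq.2 (Ne.symm hl.1)
      exact ⟨c' :: l', rfl⟩
  have hm : (0 : Fin (r+1)) ∈ w := List.count_pos_iff.1 h0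
  obtain ⟨u, t, rfl, hu⟩ := List.eq_append_cons_of_mem hm
  have key : ∀ t : List (Fin (r+1)), Avoid (0 :: t) →
      ∃ v, 0 ∉ v ∧ t = List.replicate (t.count 0) 0 ++ v := by
    intro t
    induction t with
    | nil => intro _; exact ⟨[], by simp, rfl⟩
    | cons c t ih =>
      intro ha
      by_cases hc : c = 0
      · subst hc
        obtain ⟨v, hv, he⟩ := ih (fun b c hbc hs => ha b c hbc (hs.cons _))
        refine ⟨v, hv, ?_⟩
        rw [List.count_cons_self, List.replicate_succ, List.cons_append, ← he]
      · have : 0 ∉ c :: t := by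
          rintro hmem
          rcases List.mem_cons.1 hmem with h | h
          · exact hc h.symm
          · exact ha 0 c (Fin.pos_iff_ne_zero.2 hc)
              (((List.singleton_sublist.2 h).cons_cons c).cons_cons 0)
        exact ⟨c :: t, this, by rw [List.count_eq_zero.2 this]; rfl⟩
  obtain ⟨v, hv, he⟩ := key t (fun b c hbc hs => h b c hbc (hs.trans (List.sublist_append_right _ _)))
  obtain ⟨u', rfl⟩ := lift u hu
  obtain ⟨v', rfl⟩ := lift v hv
  refine ⟨u', v', ?_⟩
  rw [List.count_append, List.count_eq_zero.2 hu, List.count_cons_self, Nat.zero_add,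
    List.replicate_succ, List.cons_append, ← he]

theorem avoid_of_insert {r : ℕ} (m : ℕ) (u v : List (Fin r))
    (h : Avoid (u.map Fin.succ ++ (List.replicate m 0 ++ v.map Fin.succ))) : Avoid (u ++ v) := by
  intro b c hbc hs
  refine h b.succ c.succ (Fin.succ_lt_succ_iff.2 hbc) ?_
  have h1 : ([b, c, b].map Fin.succ).Sublist ((u ++ v).map Fin.succ) := hs.map _
  rw [List.map_append] at h1
  exact h1.trans ((List.Sublist.refl _).append (List.sublist_append_right _ _))

theorem count_insert_zero {r : ℕ} (m : ℕ) (u v : List (Fin r)) :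
    (u.map Fin.succ ++ (List.replicate m 0 ++ v.map Fin.succ)).count 0 = m := by
  have h : ∀ l : List (Fin r), (l.map Fin.succ).count 0 = 0 := by
    intro l; rw [List.count_eq_zero]; simp
  simp [List.count_append, h]

theorem count_insert_succ {r : ℕ} (m : ℕ) (u v : List (Fin r)) (k : Fin r) :
    (u.map Fin.succ ++ (List.replicate m 0 ++ v.map Fin.succ)).count k.succ
      = (u ++ v).count k := by
  simp only [List.count_append, List.count_map_of_injective _ _ (Fin.succ_injective r),
    List.count_replicate]
  simp [Fin.succ_ne_zero, Ne.symm (Fin.succ_ne_zero k)]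

theorem length_eq_sum {r : ℕ} (i : Fin r → ℕ) (w : List (Fin r)) (h : ∀ k, w.count k = i k) :
    w.length = ∑ k, i k := by
  have := Multiset.sum_count_eq_card (s := Finset.univ) (m := (w : Multiset (Fin r))) (by simp)
  simp only [Multiset.coe_count, Multiset.coe_card, h] at this
  exact this.symm

abbrev AvoidWords (r : ℕ) (i : Fin r → ℕ) : Type :=
  {w : List (Fin r) // (∀ k, w.count k = i k) ∧ Avoid w}

def ins {r : ℕ} (i : Fin (r+1) → ℕ) (x : AvoidWords r (fun k => i k.succ) × Fin (1 + ∑ k : Fin r, i k.succ)) :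
    AvoidWords (r+1) i :=
  ⟨(x.1.1.take x.2).map Fin.succ ++ (List.replicate (i 0) 0 ++ (x.1.1.drop x.2).map Fin.succ), by
    refine ⟨fun k => ?_, avoid_insert _ _ _ (by rw [List.take_append_drop]; exact x.1.2.2)⟩
    rcases Fin.eq_zero_or_eq_succ k with rfl | ⟨k, rfl⟩
    · exact count_insert_zero _ _ _
    · rw [count_insert_succ, List.take_append_drop, x.1.2.1]⟩

theorem ins_inj_aux {r m : ℕ} (hm : 1 ≤ m) (u v u' v' : List (Fin r))
    (h : u.map Fin.succ ++ (List.replicate m 0 ++ v.map Fin.succ) =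
      u'.map Fin.succ ++ (List.replicate m 0 ++ v'.map Fin.succ)) : u = u' ∧ v = v' := by
  obtain ⟨m, rfl⟩ : ∃ n, m = n + 1 := ⟨m - 1, by omega⟩
  induction u generalizing u' with
  | nil =>
    cases u' with
    | nil =>
      simp only [List.map_nil, List.nil_append, List.append_cancel_left_eq] at h
      exact ⟨rfl, List.map_injective_iff.2 (Fin.succ_injective r) h⟩
    | cons c u' =>
      simp only [List.map_nil, List.nil_append, List.replicate_succ, List.cons_append,
        List.map_cons, List.cons.injEq] at h
      exact absurd h.1.symm (Fin.succ_ne_zero c)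
  | cons d u ih =>
    cases u' with
    | nil =>
      simp only [List.map_nil, List.nil_append, List.replicate_succ, List.cons_append,
        List.map_cons, List.cons.injEq] at h
      exact absurd h.1 (Fin.succ_ne_zero d)
    | cons c u' =>
      simp only [List.cons_append, List.map_cons, List.cons.injEq] at h
      obtain ⟨h1, h2⟩ := ih u' h.2
      exact ⟨by rw [Fin.succ_injective r h.1, h1], h2⟩

theorem ins_bij {r : ℕ} (i : Fin (r+1) → ℕ) (h0 : 1 ≤ i 0) : Function.Bijective (ins i) := by
  constructor
  · rintro ⟨⟨w, hw, ha⟩, p⟩ ⟨⟨w', hw', ha'⟩, p'⟩ h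
    have h := congrArg Subtype.val h
    simp only [ins] at h
    obtain ⟨h1, h2⟩ := ins_inj_aux h0 _ _ _ _ h
    have hl := length_eq_sum _ w hw
    have hl' := length_eq_sum _ w' hw'
    have e : w = w' := by
      rw [← List.take_append_drop p w, h1, h2, List.take_append_drop]
    have e2 : p = p' := by
      have := congrArg List.length h1
      simp only [List.length_take] at this
      ext
      omega
    subst e e2
    rfl
  · rintro ⟨w, hw, ha⟩
    obtain ⟨u, v, he⟩ := avoid_decomp w ha (by rw [hw]; exact h0)
    rw [hw] at he
    have hc : ∀ k : Fin r, (u ++ v).count k = i k.succ := by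
      intro k
      rw [← count_insert_succ (i 0), ← he, hw]
    have hl := length_eq_sum (fun k : Fin r => i k.succ) (u ++ v) hc
    rw [List.length_append] at hl
    refine ⟨(⟨u ++ v, hc, avoid_of_insert (i 0) u v (he ▸ ha)⟩, ⟨u.length, by omega⟩), ?_⟩
    apply Subtype.ext
    simp [ins, he]

theorem card_avoid (r : ℕ) : ∀ (i : Fin r → ℕ), (∀ k, 1 ≤ i k) →
    Nat.card (AvoidWords r i) = ∏ k ∈ Finset.univ.filter (fun k : Fin r => (k : ℕ) ≠ 0),
        (1 + ∑ j ∈ Finset.univ.filter (fun j : Fin r => k ≤ j), i j) := by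
  induction r with
  | zero =>
    intro i _
    have : Nat.card (AvoidWords 0 i) = 1 := by
      rw [Nat.card_eq_one_iff_unique]
      refine ⟨⟨fun a b => Subtype.ext ?_⟩, ⟨⟨[], fun k => k.elim0, ?_⟩⟩⟩
      · exact Subsingleton.elim _ _
      · exact fun k => k.elim0
    rw [this]; rfl
  | succ r ih =>
    intro i hi
    rw [← Nat.card_eq_of_bijective _ (ins_bij i (hi 0)), Nat.card_prod, ih _ (fun k => hi _),
      Nat.card_fin]
    have key : ∀ k : Fin r, ∑ j ∈ Finset.univ.filter (fun j : Fin (r+1) => k.succ ≤ j), i j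
        = ∑ j ∈ Finset.univ.filter (fun j : Fin r => k ≤ j), i j.succ := by
      intro k
      rw [Finset.sum_filter, Finset.sum_filter, Fin.sum_univ_succ]
      simp
    rw [Finset.prod_filter, Finset.prod_filter, Fin.prod_univ_succ]
    simp only [key, Fin.val_succ, Fin.val_zero]
    cases r with
    | zero => simp
    | succ r =>
      rw [Fin.prod_univ_succ, Fin.prod_univ_succ]
      simp [mul_comm]

end Sylv

/-- The number of metasylvester classes of words of packed evaluation
`(i₁, …, i_r)` equals `(1+i_r)(1+i_{r-1}+i_r)⋯(1+i₂+⋯+i_r)`, the factor indexed by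
`k ∈ {2,…,r}` being `1 + i_k + ⋯ + i_r`. -/
theorem card_metasylvester_classes (r : ℕ) (i : Fin r → ℕ) (hi : ∀ k, 1 ≤ i k) :
    Nat.card
      (Quotient (Setoid.comap
        (Subtype.val : {w : List (Fin r) // ∀ k, w.count k = i k} → List (Fin r))
        (Relation.EqvGen.setoid MetaStep))) =
      ∏ k ∈ Finset.univ.filter (fun k : Fin r => (k : ℕ) ≠ 0),
        (1 + ∑ j ∈ Finset.univ.filter (fun j : Fin r => k ≤ j), i j) := by
  rw [← Sylv.card_avoid r i hi]
  symm
  refine Nat.card_eq_of_bijective (fun w : Sylv.AvoidWords r i =>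
    Quotient.mk (Setoid.comap
        (Subtype.val : {w : List (Fin r) // ∀ k, w.count k = i k} → List (Fin r))
        (Relation.EqvGen.setoid MetaStep)) ⟨w.1, w.2.1⟩) ⟨?_, ?_⟩
  · rintro ⟨w, hw, ha⟩ ⟨w', hw', ha'⟩ h
    have h' : Relation.EqvGen MetaStep w w' := Quotient.exact h
    apply Subtype.ext
    exact Sylv.avoid_unique w w' [] ha ha' (fun a => (hw a).trans (hw' a).symm)
      (fun a => Sylv.H_eqv _ _ _ h')
  · intro q
    induction q using Quotient.inductionOn with
    | h w =>
      obtain ⟨w, hw⟩ := w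
      obtain ⟨w', he, ha⟩ := Sylv.exists_avoid w
      refine ⟨⟨w', fun k => ?_, ha⟩, ?_⟩
      · rw [← (Sylv.eqv_perm _ _ he).count_eq, hw]
      · apply Quotient.sound
        exact Relation.EqvGen.symm _ _ he
end

section
/- The number of metasylvester classes of m-permutations of n equals the product over k from 1 to n-1 of (1 + mk), i.e. (1+m)(1+2m)···(1+(n-1)m); in particular for m=1 it is n! and the metasylvester congruence is trivial on permutations. -/
/-- Unified form of the rewriting. -/
def UStep {α : Type*} [LinearOrder α] (w w' : List α) : Prop :=
  ∃ (u x : List α) (a b c : α), a ≤ b ∧ b < c ∧ b ∈ u ++ [a] ∧ b ∈ x ∧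
    w = u ++ a :: c :: x ∧ w' = u ++ c :: a :: x

theorem metaStep_iff_uStep {α : Type*} [LinearOrder α] (w w' : List α) :
    MetaStep w w' ↔ UStep w w' := by
  constructor
  · rintro (⟨u, v, x, a, b, hab, rfl, rfl⟩ | ⟨u, v, y, x, a, b, c, hab, hbc, rfl, rfl⟩)
    · exact ⟨u, v ++ [a] ++ x, a, a, b, le_rfl, hab, by simp, by simp, by simp, by simp⟩
    · exact ⟨u ++ [b] ++ v, y ++ [b] ++ x, a, b, c, hab.le, hbc, by simp, by simp, by simp, by simp⟩
  · rintro ⟨u, x, a, b, c, hab, hbc, hu, hx, rfl, rfl⟩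
    obtain ⟨s, t, rfl⟩ := List.append_of_mem hx
    rcases hab.eq_or_lt with rfl | hab
    · exact Or.inl ⟨u, s, t, a, c, hbc, by simp, by simp⟩
    · have hu' : b ∈ u := by
        rcases List.mem_append.1 hu with h | h
        · exact h
        · simp at h; exact absurd h hab.ne'
      obtain ⟨p, q, rfl⟩ := List.append_of_mem hu'
      exact Or.inr ⟨p, q, s, t, a, b, c, hab, hbc, by simp, by simp⟩

theorem UStep.perm {α : Type*} [LinearOrder α] {w w' : List α} (h : UStep w w') : w.Perm w' := by
  obtain ⟨u, x, a, b, c, -, -, -, -, rfl, rfl⟩ := h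
  exact List.Perm.append_left u (List.Perm.swap c a x)

/-- Number of noninversions. -/
def nonInv {α : Type*} [LinearOrder α] : List α → ℕ
  | [] => 0
  | x :: l => l.countP (fun y => decide (x < y)) + nonInv l

theorem UStep.nonInv_lt {α : Type*} [LinearOrder α] {w w' : List α} (h : UStep w w') :
    nonInv w' < nonInv w := by
  obtain ⟨u, x, a, b, c, h1, h2, -, -, rfl, rfl⟩ := h
  have hac : a < c := h1.trans_lt h2
  induction u with
  | nil =>
    simp [nonInv, hac, not_lt.2 hac.le]
    omega
  | cons y u ih =>
    simp only [List.cons_append, nonInv]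
    have : (u ++ c :: a :: x).countP (fun z => decide (y < z))
        = (u ++ a :: c :: x).countP (fun z => decide (y < z)) :=
      List.Perm.countP_eq _ (List.Perm.append_left u (List.Perm.swap a c x))
    omega

open Relation in
theorem UStep.local_confl {α : Type*} [LinearOrder α] {w y z : List α}
    (h : UStep w y) (h' : UStep w z) : Join (ReflTransGen UStep) y z := by
  -- wlog on lengths of the left contexts
  have key : ∀ (u x u' x' : List α) (a b c a' b' c' : α), u.length ≤ u'.length →
      a ≤ b → b < c → b ∈ u ++ [a] → b ∈ x → a' ≤ b' → b' < c' → b' ∈ u' ++ [a'] → b' ∈ x' →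
      u ++ a :: c :: x = u' ++ a' :: c' :: x' →
      Join (ReflTransGen UStep) (u ++ c :: a :: x) (u' ++ c' :: a' :: x') := by
    intro u x u' x' a b c a' b' c' hl h1 h2 h3 h4 h1' h2' h3' h4' he
    have hpre : u <+: u' := by
      refine List.prefix_of_prefix_length_le (l₃ := u ++ a :: c :: x) (List.prefix_append _ _) ?_ hl
      rw [he]; exact List.prefix_append _ _
    obtain ⟨s, rfl⟩ := hpre
    rw [List.append_assoc, List.append_cancel_left_eq] at he
    rcases s with _ | ⟨s1, _ | ⟨s2, s⟩⟩
    · simp at he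
      obtain ⟨rfl, rfl, rfl⟩ := he
      simp
      exact ⟨_, .refl, .refl⟩
    · simp at he
      obtain ⟨rfl, rfl, rfl⟩ := he
      have hbx : b ∈ x' := by
        rcases List.mem_cons.1 h4 with h | h
        · subst h; exact absurd (h1'.trans_lt h2') (not_lt.2 h2.le)
        · exact h
      have hbu : b' ∈ u ++ [c] := by
        simp at h3' ⊢
        rcases h3' with h | h | h
        · exact Or.inl h
        · subst h; exact absurd (h1.trans_lt h2) (not_lt.2 h1')
        · exact Or.inr h
      have hcc : b < c' := h2.trans_le (h1'.trans h2'.le)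
      refine ⟨u ++ c' :: c :: a :: x', ?_, ?_⟩
      · refine .tail (.single (b := u ++ c :: c' :: a :: x') ?_) ?_
        · refine ⟨u ++ [c], x', a, b, c', h1, hcc, ?_, hbx, by simp, by simp⟩
          simp at h3 ⊢; tauto
        · exact ⟨u, a :: x', c, b', c', h1', h2', hbu, by simp [h4'], rfl, rfl⟩
      · refine .tail (.single (b := u ++ c' :: a :: c :: x') ?_) ?_
        · exact ⟨u, c :: x', a, b, c', h1, hcc, h3, by simp [hbx], by simp, by simp⟩
        · refine ⟨u ++ [c'], x', a, b, c, h1, h2, ?_, hbx, by simp, by simp⟩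
          simp at h3 ⊢; tauto
    · simp at he
      obtain ⟨rfl, rfl, rfl⟩ := he
      refine ⟨u ++ c :: a :: (s ++ c' :: a' :: x'), .single ?_, .single ?_⟩
      · refine ⟨u ++ c :: a :: s, x', a', b', c', h1', h2', ?_, h4', by simp, by simp⟩
        simp at h3' ⊢; tauto
      · refine ⟨u, s ++ c' :: a' :: x', a, b, c, h1, h2, h3, ?_, by simp, by simp⟩
        simp at h4 ⊢; tauto
  obtain ⟨u, x, a, b, c, h1, h2, h3, h4, rfl, rfl⟩ := h
  obtain ⟨u', x', a', b', c', h1', h2', h3', h4', he, rfl⟩ := h'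
  rcases le_total u.length u'.length with hl | hl
  · exact key _ _ _ _ _ _ _ _ _ _ hl h1 h2 h3 h4 h1' h2' h3' h4' he
  · exact Join.symm.symm _ _ (key _ _ _ _ _ _ _ _ _ _ hl h1' h2' h3' h4' h1 h2 h3 h4 he.symm)

open Relation in
theorem UStep.confl {α : Type*} [LinearOrder α] (N : ℕ) : ∀ (w : List α), nonInv w = N → ∀ y z,
    ReflTransGen UStep w y → ReflTransGen UStep w z → Join (ReflTransGen UStep) y z := by
  induction N using Nat.strong_induction_on with
  | _ N ih =>
  intro w hw y z hy hz
  rcases hy.cases_head with rfl | ⟨y1, hy1, hy2⟩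
  · exact ⟨z, hz, .refl⟩
  rcases hz.cases_head with rfl | ⟨z1, hz1, hz2⟩
  · exact ⟨y, .refl, hy⟩
  obtain ⟨d, hd1, hd2⟩ := UStep.local_confl hy1 hz1
  obtain ⟨e, he1, he2⟩ := ih _ (hw ▸ hy1.nonInv_lt) y1 rfl y d hy2 hd1
  obtain ⟨f, hf1, hf2⟩ := ih _ (hw ▸ hz1.nonInv_lt) z1 rfl e z (hd2.trans he2) hz2
  exact ⟨f, he1.trans hf1, hf2⟩

open Relation in
theorem UStep.join_of_eqvGen {α : Type*} [LinearOrder α] {y z : List α}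
    (h : EqvGen UStep y z) : Join (ReflTransGen UStep) y z := by
  induction h with
  | rel x y h => exact ⟨y, .single h, .refl⟩
  | refl x => exact ⟨x, .refl, .refl⟩
  | symm x y _ ih => exact Join.symm.symm _ _ ih
  | trans x y z _ _ ih1 ih2 =>
    obtain ⟨d, h1, h2⟩ := ih1
    obtain ⟨e, h3, h4⟩ := ih2
    obtain ⟨f, h5, h6⟩ := UStep.confl _ y rfl d e h2 h3
    exact ⟨f, h1.trans h5, h4.trans h6⟩

/-- Avoidance of the pattern 121. -/
def Avoids {α : Type*} [LinearOrder α] (w : List α) : Prop :=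
  ∀ a b, a < b → ¬ List.Sublist [a, b, a] w

theorem exists_uStep {α : Type*} [LinearOrder α] {a b : α} (hab : a < b) (t : List α) :
    ∀ (u : List α) (a' : α), a' ≤ a → a ∈ u ++ [a'] → List.Sublist [b, a] t →
      ∃ w', UStep (u ++ a' :: t) w' := by
  induction t with
  | nil => intro u a' _ _ h; simp at h
  | cons y t ih =>
    intro u a' h1 h2 h3
    by_cases hy : a < y
    · refine ⟨_, u, t, a', a, y, h1, hy, h2, ?_, rfl, rfl⟩
      exact List.singleton_sublist.1 (by simpa using h3.tail)
    · have h4 : List.Sublist [b, a] t := by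
        rcases List.sublist_cons_iff.1 h3 with h | ⟨r, hr, h⟩
        · exact h
        · simp at hr; exact absurd (hr.1 ▸ hab) hy
      obtain ⟨w', hw'⟩ := ih (u ++ [a']) y (not_lt.1 hy) (by simp at h2 ⊢; tauto) h4
      exact ⟨w', by simpa using hw'⟩

theorem avoids_of_normal {α : Type*} [LinearOrder α] {w : List α} (h : ∀ w', ¬ UStep w w') :
    Avoids w := by
  intro a b hab hs
  obtain ⟨p, q, rfl, hp, hq⟩ := List.cons_sublist_iff.1 hs
  obtain ⟨u, v, rfl⟩ := List.append_of_mem hp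
  obtain ⟨w', hw'⟩ := exists_uStep hab (v ++ q) u a le_rfl (by simp)
    (hq.trans (List.sublist_append_right _ _))
  exact h w' (by simpa using hw')

theorem normal_of_avoids {α : Type*} [LinearOrder α] {w : List α} (h : Avoids w) :
    ∀ w', ¬ UStep w w' := by
  rintro w' ⟨u, x, a, b, c, h1, h2, h3, h4, rfl, -⟩
  refine h b c h2 ?_
  have e : [b, c, b] = [b] ++ ([c] ++ [b]) := rfl
  have e' : u ++ a :: c :: x = (u ++ [a]) ++ ([c] ++ x) := by simp
  rw [e, e']
  exact (List.singleton_sublist.2 h3).append ((List.Sublist.refl _).append (List.singleton_sublist.2 h4))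

open Relation in
theorem exists_avoids {α : Type*} [LinearOrder α] (N : ℕ) : ∀ w : List α, nonInv w = N →
    ∃ z, ReflTransGen UStep w z ∧ Avoids z := by
  induction N using Nat.strong_induction_on with
  | _ N ih =>
  intro w hw
  by_cases h : ∃ w', UStep w w'
  · obtain ⟨w', h⟩ := h
    obtain ⟨z, hz, hz'⟩ := ih _ (hw ▸ h.nonInv_lt) w' rfl
    exact ⟨z, hz.head h, hz'⟩
  · exact ⟨w, .refl, avoids_of_normal (by simpa using h)⟩

/-- Avoiding `m`-permutations. -/
abbrev AvPerm (m n : ℕ) : Type := {w : List (Fin n) // (∀ k, w.count k = m) ∧ Avoids w}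

open Relation in
theorem card_quot (m n : ℕ) : Nat.card
      (Quotient (Setoid.comap
        (Subtype.val : {w : List (Fin n) // ∀ k, w.count k = m} → List (Fin n))
        (Relation.EqvGen.setoid MetaStep))) = Nat.card (AvPerm m n) := by
  symm
  have hM : (MetaStep : List (Fin n) → List (Fin n) → Prop) = UStep := by
    funext w w'; exact propext (metaStep_iff_uStep w w')
  rw [hM]
  refine Nat.card_congr (Equiv.ofBijective
    (fun w => Quotient.mk _ ⟨w.1, w.2.1⟩) ⟨?_, ?_⟩)
  · intro x y h
    have h' : EqvGen UStep x.1 y.1 := Quotient.exact h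
    obtain ⟨d, h1, h2⟩ := UStep.join_of_eqvGen h'
    have e : ∀ z : AvPerm m n, ReflTransGen UStep z.1 d → z.1 = d := by
      intro z hz
      rcases hz.cases_head with h | ⟨c, h, -⟩
      · exact h
      · exact absurd h (normal_of_avoids z.2.2 c)
    exact Subtype.ext ((e x h1).trans (e y h2).symm)
  · intro q
    induction q using Quotient.inductionOn with
    | _ w =>
    obtain ⟨z, hz, hz'⟩ := exists_avoids _ w.1 rfl
    have hp : w.1.Perm z := by
      clear hz'
      induction hz with
      | refl => exact List.Perm.refl _
      | tail _ h ih => exact ih.trans h.perm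
    refine ⟨⟨z, fun k => (hp.count_eq k).symm.trans (w.2 k), hz'⟩, Quotient.sound ?_⟩
    change EqvGen UStep z w.1
    refine EqvGen.symm _ _ ?_
    clear hz' hp
    induction hz with
    | refl => exact EqvGen.refl _
    | tail _ h ih => exact ih.trans _ _ _ (EqvGen.rel _ _ h)

theorem length_eq {m n : ℕ} {w : List (Fin n)} (h : ∀ k, w.count k = m) : w.length = m * n := by
  have := Multiset.sum_count_eq_card (s := (Finset.univ : Finset (Fin n))) (m := (w : Multiset (Fin n)))
    (fun a _ => Finset.mem_univ a)
  simp [h] at this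
  rw [← this, mul_comm]

theorem avoids_insert {n : ℕ} {p r : List (Fin (n+1))} (k : ℕ) (hp : 0 ∉ p) (hr : 0 ∉ r)
    (h : Avoids (p ++ r)) : Avoids (p ++ List.replicate k 0 ++ r) := by
  intro a b hab hs
  by_cases ha : a = 0
  · subst ha
    clear h
    induction p with
    | nil =>
      have h2 : ∀ k : ℕ, List.Sublist [b, 0] (List.replicate k 0 ++ r) → False := by
        intro k
        induction k with
        | zero => intro h; exact hr (h.subset (by simp))
        | succ k ih =>
          intro h
          rw [List.replicate_succ, List.cons_append] at h
          rcases List.sublist_cons_iff.1 h with h | ⟨s, hs, h⟩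
          · exact ih h
          · simp at hs; exact hab.ne' hs.1
      exact h2 k (by simpa using (List.sublist_cons_self _ _).trans hs)
    | cons x p ih =>
      simp at hp
      rw [List.cons_append, List.cons_append] at hs
      rcases List.sublist_cons_iff.1 hs with h | ⟨s, hs, h⟩
      · exact ih hp.2 h
      · simp at hs; exact hp.1 hs.1
  · refine h a b hab ?_
    have hb : b ≠ 0 := fun hb => by subst hb; exact absurd hab (by simp)
    have := hs.filter (fun y => decide (y ≠ 0))
    have fp : p.filter (fun y => decide (y ≠ 0)) = p :=
      List.filter_eq_self.2 (fun y hy => by simp; rintro rfl; exact hp hy)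
    have fr : r.filter (fun y => decide (y ≠ 0)) = r :=
      List.filter_eq_self.2 (fun y hy => by simp; rintro rfl; exact hr hy)
    rw [List.filter_append, List.filter_append, fp, fr] at this
    simpa [ha, hb] using this

theorem avoids_map {n : ℕ} {w : List (Fin n)} : Avoids (w.map Fin.succ) ↔ Avoids w := by
  constructor
  · intro h a b hab hs
    exact h a.succ b.succ (by simpa using hab) (by simpa using hs.map Fin.succ)
  · intro h a b hab hs
    obtain ⟨l, hl, he⟩ := List.sublist_map_iff.1 hs
    have h3 : l.length = 3 := by
      have := congrArg List.length he
      simpa using this.symm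
    obtain ⟨x, y, z, rfl⟩ := List.length_eq_three.1 h3
    simp at he
    obtain ⟨rfl, rfl, he⟩ := he
    have hxz := Fin.succ_injective _ he
    subst hxz
    exact h x y (by simpa using hab) hl

/-- Insertion of a block of zeros. -/
def insZ {n : ℕ} (m : ℕ) (w : List (Fin n)) (i : ℕ) : List (Fin (n+1)) :=
  (w.map Fin.succ).take i ++ List.replicate m 0 ++ (w.map Fin.succ).drop i

theorem zero_notMem_take {n : ℕ} (w : List (Fin n)) (i : ℕ) : 0 ∉ (w.map Fin.succ).take i := by
  intro h
  have := List.mem_of_mem_take h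
  simp at this

theorem zero_notMem_drop {n : ℕ} (w : List (Fin n)) (i : ℕ) : 0 ∉ (w.map Fin.succ).drop i := by
  intro h
  have := List.mem_of_mem_drop h
  simp at this

theorem count_insZ {n m : ℕ} (w : List (Fin n)) (i : ℕ) (k : Fin (n+1)) :
    (insZ m w i).count k = (w.map Fin.succ).count k + (List.replicate m 0).count k := by
  conv_rhs => rw [← List.take_append_drop i (w.map Fin.succ)]
  simp only [insZ, List.count_append]
  omega

theorem count_map_zero {n : ℕ} (w : List (Fin n)) : (w.map Fin.succ).count 0 = 0 :=
  List.count_eq_zero.2 (by simp)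

theorem block_decomp {n : ℕ} (w : List (Fin (n+1))) (h : Avoids w) (h0 : 0 ∈ w) :
    ∃ p r k, 0 ∉ p ∧ 0 ∉ r ∧ w = p ++ List.replicate k 0 ++ r := by
  have h2 : ∀ q : List (Fin (n+1)), Avoids (0 :: q) → ∃ r k, 0 ∉ r ∧ q = List.replicate k 0 ++ r := by
    intro q
    induction q with
    | nil => intro _; exact ⟨[], 0, by simp, by simp⟩
    | cons y q ih =>
      intro hq
      by_cases hy : y = 0
      · subst hy
        obtain ⟨r, k, hr, rfl⟩ := ih (fun a b hab hs => hq a b hab (hs.trans (List.sublist_cons_self _ _)))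
        exact ⟨r, k + 1, hr, by simp [List.replicate_succ]⟩
      · refine ⟨y :: q, 0, ?_, by simp⟩
        intro hm
        rcases List.mem_cons.1 hm with h | h
        · exact hy h.symm
        · exact hq 0 y (Fin.pos_of_ne_zero hy)
            (((List.singleton_sublist.2 h).cons_cons y).cons_cons 0)
  obtain ⟨p, q, rfl, hp⟩ : ∃ p q, w = p ++ 0 :: q ∧ 0 ∉ p := by
    obtain ⟨p, q, hp, he⟩ := List.eq_append_cons_of_mem h0
    exact ⟨p, q, by tauto, by tauto⟩
  obtain ⟨r, k, hr, rfl⟩ := h2 q (fun a b hab hs => h a b hab (hs.trans (List.sublist_append_right _ _)))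
  exact ⟨p, r, k + 1, hp, hr, by simp [List.replicate_succ]⟩

theorem exists_map_succ {n : ℕ} (w : List (Fin (n+1))) (h : 0 ∉ w) :
    ∃ v : List (Fin n), v.map Fin.succ = w := by
  induction w with
  | nil => exact ⟨[], rfl⟩
  | cons x w ih =>
    simp at h
    obtain ⟨v, rfl⟩ := ih h.2
    obtain ⟨y, rfl⟩ := Fin.exists_succ_eq.2 (Ne.symm h.1)
    exact ⟨y :: v, rfl⟩

theorem card_succ (m n : ℕ) (hm : 1 ≤ m) :
    Nat.card (AvPerm m (n+1)) = Nat.card (AvPerm m n) * (1 + m * n) := by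
  have e : 1 + m * n = Nat.card (Fin (1 + m * n)) := by simp
  rw [e, ← Nat.card_prod]
  symm
  refine Nat.card_congr (Equiv.ofBijective
    (fun x => ⟨insZ m x.1.1 x.2.1, ?_, ?_⟩) ⟨?_, ?_⟩)
  · intro k
    rw [count_insZ]
    refine Fin.cases ?_ (fun k => ?_) k
    · simp [count_map_zero]
    · rw [List.count_map_of_injective _ _ (Fin.succ_injective n), x.1.2.1 k]
      simp [List.count_replicate, (Fin.succ_ne_zero k).symm]
  · refine avoids_insert m (zero_notMem_take _ _) (zero_notMem_drop _ _) ?_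
    rw [List.take_append_drop]
    exact avoids_map.2 x.1.2.2
  · rintro ⟨⟨w, hw, hwa⟩, i⟩ ⟨⟨w', hw', hwa'⟩, i'⟩ h
    have h : insZ m w i.1 = insZ m w' i'.1 := congrArg Subtype.val h
    have hf : ∀ (v : List (Fin n)) (i : ℕ),
        (insZ m v i).filter (fun y => decide (y ≠ 0)) = v.map Fin.succ := by
      intro v i
      have fp : ((v.map Fin.succ).take i).filter (fun y => decide (y ≠ 0)) = (v.map Fin.succ).take i :=
        List.filter_eq_self.2 (fun y hy => by simp; rintro rfl; exact zero_notMem_take v i hy)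
      have fr : ((v.map Fin.succ).drop i).filter (fun y => decide (y ≠ 0)) = (v.map Fin.succ).drop i :=
        List.filter_eq_self.2 (fun y hy => by simp; rintro rfl; exact zero_notMem_drop v i hy)
      rw [insZ, List.filter_append, List.filter_append, fp, fr]
      conv_rhs => rw [← List.take_append_drop i (v.map Fin.succ)]
      simp
    have hi : ∀ (v : List (Fin n)) (i : ℕ), i ≤ v.length → (insZ m v i).idxOf 0 = i := by
      intro v j hj
      obtain ⟨m, rfl⟩ : ∃ m', m = m' + 1 := ⟨m - 1, by omega⟩
      rw [insZ, List.append_assoc, List.idxOf_append_of_notMem (zero_notMem_take v j)]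
      simp [List.replicate_succ, hj]
    have e1 : w = w' := by
      have := hf w i
      rw [h, hf w' i'] at this
      exact ((List.map_injective_iff.2 (Fin.succ_injective n)) this).symm
    have l1 := length_eq hw
    have l2 := length_eq hw'
    have e2 : i = i' := by
      apply Fin.ext
      rw [← hi w i (by have := i.2; omega), h, hi w' i' (by have := i'.2; omega)]
    subst e1 e2
    rfl
  · rintro ⟨w, hw, hwa⟩
    obtain ⟨p, r, k, hp, hr, rfl⟩ := block_decomp w hwa
      (List.count_pos_iff.1 (by rw [hw]; omega))
    have hk : k = m := by
      have := hw 0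
      simpa [List.count_append, List.count_eq_zero.2 hp, List.count_eq_zero.2 hr] using this
    subst hk
    obtain ⟨v, hv⟩ := exists_map_succ (p ++ r) (by simp [hp, hr])
    have hc : ∀ j, v.count j = k := by
      intro j
      rw [← List.count_map_of_injective _ _ (Fin.succ_injective n), hv, ← hw j.succ]
      simp [List.count_append, List.count_replicate, (Fin.succ_ne_zero j).symm]
    have hav : Avoids v := by
      rw [← avoids_map, hv]
      intro a b hab hs
      refine hwa a b hab (hs.trans ?_)
      rw [List.append_assoc]
      exact (List.Sublist.refl p).append (List.sublist_append_right _ _)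
    have hl : p.length ≤ k * n := by
      rw [← length_eq hc]
      have := congrArg List.length hv
      simp at this
      omega
    refine ⟨⟨⟨v, hc, hav⟩, ⟨p.length, by omega⟩⟩, Subtype.ext ?_⟩
    simp [insZ, hv]

theorem card_avPerm (m n : ℕ) (hm : 1 ≤ m) :
    Nat.card (AvPerm m n) = ∏ k ∈ Finset.range n, (1 + m * k) := by
  induction n with
  | zero =>
    simp only [Finset.range_zero, Finset.prod_empty]
    rw [Nat.card_eq_one_iff_unique]
    refine ⟨⟨fun x y => Subtype.ext ?_⟩, ⟨⟨[], fun k => k.elim0, by intro a; exact a.elim0⟩⟩⟩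
    rw [List.eq_nil_iff_forall_not_mem.2 (fun a => a.elim0 : ∀ a, a ∉ x.1),
      List.eq_nil_iff_forall_not_mem.2 (fun a => a.elim0 : ∀ a, a ∉ y.1)]
  | succ n ih => rw [card_succ m n hm, ih, Finset.prod_range_succ]

theorem prod_Ico_eq (m n : ℕ) :
    ∏ k ∈ Finset.Ico 1 n, (1 + m * k) = ∏ k ∈ Finset.range n, (1 + m * k) := by
  cases n with
  | zero => simp
  | succ n => rw [Finset.range_eq_Ico, Finset.prod_eq_prod_Ico_succ_bot (Nat.succ_pos n)]; simp

theorem not_uStep {α : Type*} [LinearOrder α] {w w' : List α} (h : w.Nodup) : ¬ UStep w w' := by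
  refine normal_of_avoids (fun a b hab hs => ?_) w'
  have := h.sublist hs
  simp at this

/-- The number of metasylvester classes of `m`-permutations of `n`
equals `(1+m)(1+2m)⋯(1+(n-1)m)`; in particular for `m = 1` this is `n!` and the
metasylvester congruence is trivial on permutations. -/
theorem card_metasylvester_classes_mPermutations (m n : ℕ) (hm : 1 ≤ m) :
    Nat.card
      (Quotient (Setoid.comap
        (Subtype.val : {w : List (Fin n) // ∀ k, w.count k = m} → List (Fin n))
        (Relation.EqvGen.setoid MetaStep))) =
      ∏ k ∈ Finset.Ico 1 n, (1 + m * k) ∧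
    (m = 1 →
      (∏ k ∈ Finset.Ico 1 n, (1 + m * k)) = Nat.factorial n ∧
      ∀ w w' : List (Fin n), (∀ k, w.count k = 1) →
        Relation.EqvGen MetaStep w w' → w = w') := by
  rw [prod_Ico_eq, card_quot, card_avPerm m n hm]
  refine ⟨rfl, ?_⟩
  rintro rfl
  refine ⟨?_, ?_⟩
  · rw [← Finset.prod_range_add_one_eq_factorial]
    exact Finset.prod_congr rfl (fun k _ => by ring)
  · intro w w' hw h
    have hM : (MetaStep : List (Fin n) → List (Fin n) → Prop) = UStep := by
      funext w w'; exact propext (metaStep_iff_uStep w w')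
    rw [hM] at h
    have hnd : w.Nodup := List.nodup_iff_count_le_one.2 (fun a => (hw a).le)
    have key : (w.Nodup ↔ w'.Nodup) ∧ (w.Nodup → w = w') := by
      clear hw hnd
      induction h with
      | rel x y h => exact ⟨h.perm.nodup_iff, fun hx => absurd h (not_uStep hx)⟩
      | refl x => exact ⟨Iff.rfl, fun _ => rfl⟩
      | symm x y _ ih => exact ⟨ih.1.symm, fun hy => (ih.2 (ih.1.2 hy)).symm⟩
      | trans x y z _ _ ih1 ih2 =>
        exact ⟨ih1.1.trans ih2.1, fun hx => (ih1.2 hx).trans (ih2.2 (ih1.1.1 hx))⟩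
    exact key.2 hnd
end

section
/- The number of metasylvester classes of words of evaluation (m^n) (m-permutations of n) equals the number of decreasing (m+1)-ary trees on n labeled nodes, i.e. rooted plane trees with n internal nodes labeled bijectively by 1,...,n, each internal node having m+1 (possibly empty) ordered subtrees, and each node's label being greater than the labels of all its descendants; this count is ∏_{k=1}^{n-1}(1+mk). -/
/-- Plane `(m+1)`-ary trees with internal nodes labeled by natural numbers;
each internal node carries `m+1` ordered (possibly empty) subtrees. -/
inductive MTree (m : ℕ) : Type
  | leaf : MTree m
  | node : ℕ → (Fin (m + 1) → MTree m) → MTree m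

/-- The multiset of labels of the internal nodes of an `(m+1)`-ary tree. -/
def MTree.labels {m : ℕ} : MTree m → Multiset ℕ
  | .leaf => 0
  | .node l ts => l ::ₘ ∑ i : Fin (m + 1), (ts i).labels

/-- A labeled tree is decreasing if each node's label is greater than the labels of
all its descendants. -/
def MTree.Decreasing {m : ℕ} : MTree m → Prop
  | .leaf => True
  | .node l ts => ∀ i : Fin (m + 1),
      (∀ x ∈ (ts i).labels, x < l) ∧ (ts i).Decreasing

namespace MS

variable {n : ℕ}

/-- number of `c` before the last `a` -/
def I (a c : Fin n) : List (Fin n) → ℕ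
  | [] => 0
  | x :: t => if a ∈ t then (if x = c then 1 else 0) + I a c t else 0

/-- words avoiding `a b a` with `a < b` -/
def Av (w : List (Fin n)) : Prop := ∀ a b : Fin n, a < b → ¬ [a, b, a].Sublist w

/-- the pair `(a,c)` is guarded by an intermediate letter -/
def G (a c : Fin n) (w : List (Fin n)) : Prop :=
  ∃ b, a < b ∧ b < c ∧ 0 < I a b w ∧ I a b w < w.count b

def Inv (w w' : List (Fin n)) : Prop :=
  w.Perm w' ∧ ∀ a c, a < c → (G a c w ↔ G a c w') ∧ (¬ G a c w → I a c w = I a c w')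

theorem Inv.refl (w : List (Fin n)) : Inv w w := ⟨List.Perm.refl _, fun _ _ _ => ⟨Iff.rfl, fun _ => rfl⟩⟩

theorem Inv.symm {w w' : List (Fin n)} (h : Inv w w') : Inv w' w :=
  ⟨h.1.symm, fun a c hac => ⟨(h.2 a c hac).1.symm, fun hg =>
    ((h.2 a c hac).2 (fun h' => hg ((h.2 a c hac).1.1 h'))).symm⟩⟩

theorem Inv.trans {w w' w'' : List (Fin n)} (h : Inv w w') (h' : Inv w' w'') : Inv w w'' :=
  ⟨h.1.trans h'.1, fun a c hac => ⟨(h.2 a c hac).1.trans (h'.2 a c hac).1, fun hg =>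
    ((h.2 a c hac).2 hg).trans ((h'.2 a c hac).2 (fun h'' => hg ((h.2 a c hac).1.2 h'')))⟩⟩

theorem I_prefix (a c : Fin n) (u t t' : List (Fin n)) (hp : t.Perm t') (h : I a c t = I a c t') :
    I a c (u ++ t) = I a c (u ++ t') := by
  induction u with
  | nil => simpa using h
  | cons x u ih =>
    simp only [List.cons_append, I, ih, List.mem_append, hp.mem_iff]

theorem I_eq (a c : Fin n) (hac : a ≠ c) (s t : List (Fin n)) (ht : a ∉ t) :
    I a c (s ++ a :: t) = s.count c := by
  induction s with
  | nil => simp [I, ht]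
  | cons x s ih =>
    simp only [List.cons_append, I, ih, List.mem_append, List.mem_cons, true_or, or_true, if_true,
      List.count_cons, beq_iff_eq]
    omega

theorem I_eq_zero (a c : Fin n) (t : List (Fin n)) (ht : a ∉ t) : I a c t = 0 := by
  cases t with
  | nil => rfl
  | cons x t => simp only [List.mem_cons, not_or] at ht; simp [I, ht.2]

theorem exists_last (a : Fin n) (w : List (Fin n)) (h : a ∈ w) :
    ∃ s t, w = s ++ a :: t ∧ a ∉ t := by
  induction w with
  | nil => simp at h
  | cons x w ih =>
    by_cases hw : a ∈ w
    · obtain ⟨s, t, rfl, ht⟩ := ih hw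
      exact ⟨x :: s, t, rfl, ht⟩
    · have : a = x := by simpa [hw] using h
      subst this
      exact ⟨[], w, rfl, hw⟩

theorem step_inv {w w' : List (Fin n)} (h : MetaStep w w') : Inv w w' := by
  rcases h with ⟨u, v, x, a, b, hab, rfl, rfl⟩ | ⟨u, v, y, x, a, b, c, hab, hbc, rfl, rfl⟩
  · have hp : (a :: b :: (v ++ a :: x)).Perm (b :: a :: (v ++ a :: x)) := List.Perm.swap _ _ _
    have hI : ∀ a' c', a' < c' → I a' c' (u ++ [a, b] ++ v ++ [a] ++ x) =
        I a' c' (u ++ [b, a] ++ v ++ [a] ++ x) := by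
      intro a' c' h'
      have := I_prefix a' c' u _ _ hp (by
        simp only [I, List.mem_cons, List.mem_append]
        grind)
      simpa using this
    have hP : (u ++ [a, b] ++ v ++ [a] ++ x).Perm (u ++ [b, a] ++ v ++ [a] ++ x) := by
      simpa using hp.append_left u
    refine ⟨hP, fun a' c' h' => ⟨?_, fun _ => hI _ _ h'⟩⟩
    unfold G
    refine exists_congr fun d => ?_
    constructor
    · rintro ⟨h1, h2, h3, h4⟩
      refine ⟨h1, h2, ?_, ?_⟩
      · rwa [← hI _ _ h1]
      · rwa [← hI _ _ h1, ← hP.count_eq]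
    · rintro ⟨h1, h2, h3, h4⟩
      refine ⟨h1, h2, ?_, ?_⟩
      · rwa [hI _ _ h1]
      · rwa [hI _ _ h1, hP.count_eq]
  · have hp : (a :: c :: (y ++ b :: x)).Perm (c :: a :: (y ++ b :: x)) := List.Perm.swap _ _ _
    set w := u ++ [b] ++ v ++ [a, c] ++ y ++ [b] ++ x with hw
    set w' := u ++ [b] ++ v ++ [c, a] ++ y ++ [b] ++ x with hw'
    have hI : ∀ a' c', a' < c' → (a' = a → c' = c → False) → I a' c' w = I a' c' w' := by
      intro a' c' h' hne
      have := I_prefix a' c' (u ++ [b] ++ v) _ _ hp (by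
        simp only [I, List.mem_cons, List.mem_append]
        grind)
      simpa [hw, hw'] using this
    have hP : w.Perm w' := by
      simpa [hw, hw'] using hp.append_left (u ++ [b] ++ v)
    by_cases hax : a ∈ y ++ b :: x
    · -- then everything is equal
      have hI2 : ∀ a' c', a' < c' → I a' c' w = I a' c' w' := by
        intro a' c' h'
        have := I_prefix a' c' (u ++ [b] ++ v) _ _ hp (by
          simp only [List.mem_cons, List.mem_append] at hax
          simp only [I, List.mem_cons, List.mem_append]
          grind)
        simpa [hw, hw'] using this
      refine ⟨hP, fun a' c' h' => ⟨?_, fun _ => hI2 _ _ h'⟩⟩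
      unfold G
      refine exists_congr fun d => ?_
      constructor
      · rintro ⟨h1, h2, h3, h4⟩
        refine ⟨h1, h2, ?_, ?_⟩
        · rwa [← hI2 _ _ h1]
        · rwa [← hI2 _ _ h1, ← hP.count_eq]
      · rintro ⟨h1, h2, h3, h4⟩
        refine ⟨h1, h2, ?_, ?_⟩
        · rwa [hI2 _ _ h1]
        · rwa [hI2 _ _ h1, hP.count_eq]
    · have hb : I a b w = (u ++ [b] ++ v).count b := by
        have := I_eq a b hab.ne (u ++ [b] ++ v) (c :: (y ++ b :: x)) (by
          simp only [List.mem_cons, not_or]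
          exact ⟨(hab.trans hbc).ne, hax⟩)
        rw [← this, hw]
        simp
      have hb1 : 0 < I a b w := by
        rw [hb]; simp
      have hb2 : I a b w < w.count b := by
        rw [hb, hw]; simp [List.count_append]
      have hbI : I a b w = I a b w' := hI a b hab (fun _ h => hbc.ne h)
      have hb1' : 0 < I a b w' := hbI ▸ hb1
      have hb2' : I a b w' < w'.count b := by rw [← hbI, ← hP.count_eq]; exact hb2
      refine ⟨hP, fun a' c' h' => ⟨?_, fun hg => ?_⟩⟩
      · by_cases hh : a' = a ∧ c < c'
        · obtain ⟨rfl, hc⟩ := hh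
          exact ⟨fun _ => ⟨b, hab, hbc.trans hc, hb1', hb2'⟩,
            fun _ => ⟨b, hab, hbc.trans hc, hb1, hb2⟩⟩
        · unfold G
          refine exists_congr fun d => ?_
          constructor
          · rintro ⟨h1, h2, h3, h4⟩
            have hq := hI a' d h1 (by rintro rfl rfl; exact hh ⟨rfl, h2⟩)
            refine ⟨h1, h2, ?_, ?_⟩
            · rwa [← hq]
            · rwa [← hq, ← hP.count_eq]
          · rintro ⟨h1, h2, h3, h4⟩
            have hq := hI a' d h1 (by rintro rfl rfl; exact hh ⟨rfl, h2⟩)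
            refine ⟨h1, h2, ?_, ?_⟩
            · rwa [hq]
            · rwa [hq, hP.count_eq]
      · apply hI _ _ h'
        rintro rfl rfl
        exact hg ⟨b, hab, hbc, hb1, hb2⟩

theorem eqv_inv {w w' : List (Fin n)} (h : Relation.EqvGen MetaStep w w') : Inv w w' := by
  induction h with
  | rel _ _ h => exact step_inv h
  | refl _ => exact Inv.refl _
  | symm _ _ _ ih => exact ih.symm
  | trans _ _ _ _ _ ih1 ih2 => exact ih1.trans ih2

theorem Av.guard {w : List (Fin n)} (hw : Av w) {a b c : Fin n} (hab : a < b) (hbc : b < c)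
    (h1 : 0 < I a b w) (h2 : I a b w < w.count b) : I a c w = I b c w := by
  have ha : a ∈ w := by
    by_contra h
    rw [I_eq_zero _ _ _ h] at h1
    exact lt_irrefl _ h1
  obtain ⟨s, t, rfl, ht⟩ := exists_last a w ha
  rw [I_eq a b hab.ne s t ht] at h1 h2
  have hbt : b ∈ t := by
    rw [List.count_append, List.count_cons_of_ne hab.ne] at h2
    exact List.count_pos_iff.1 (by omega)
  obtain ⟨t1, t2, rfl, ht2⟩ := exists_last b t hbt
  rw [I_eq a c (hab.trans hbc).ne s _ ht]
  have := I_eq b c hbc.ne (s ++ a :: t1) t2 ht2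
  rw [show s ++ a :: (t1 ++ b :: t2) = (s ++ a :: t1) ++ b :: t2 by simp, this,
    List.count_append, List.count_cons_of_ne (hab.trans hbc).ne]
  have hc : c ∉ t1 := by
    intro hc
    apply hw b c hbc
    have e1 : [b].Sublist s := List.singleton_sublist.2 (List.count_pos_iff.1 h1)
    have e2 : [c].Sublist t1 := List.singleton_sublist.2 hc
    have e3 : [b].Sublist (b :: t2) := by simp
    have := e1.append ((e2.append e3).trans (List.sublist_cons_self a _))
    simpa using this
  rw [List.count_eq_zero_of_not_mem hc]
  rfl

theorem Av.I_eq_of_inv {w w' : List (Fin n)} (hw : Av w) (hw' : Av w') (h : Inv w w') :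
    ∀ (k : ℕ) (a c : Fin n), a < c → (c : ℕ) - a ≤ k → I a c w = I a c w' := by
  intro k
  induction k with
  | zero => intro a c hac hk; have : (a : ℕ) < c := hac; omega
  | succ k ih =>
    intro a c hac hk
    by_cases hg : G a c w
    · obtain ⟨b, hab, hbc, h1, h2⟩ := hg
      have hab' : (a : ℕ) < b := hab
      have hbc' : (b : ℕ) < c := hbc
      have e1 := ih a b hab (by omega)
      have e2 := ih b c hbc (by omega)
      rw [hw.guard hab hbc h1 h2, hw'.guard hab hbc (e1 ▸ h1) (by rw [← e1, ← h.1.count_eq]; exact h2), e2]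
    · exact (h.2 a c hac).2 hg

theorem Av.tail {x : Fin n} {w : List (Fin n)} (h : Av (x :: w)) : Av w :=
  fun a b hab hs => h a b hab (hs.trans (List.sublist_cons_self _ _))

theorem head_aux {x y : Fin n} {s t : List (Fin n)} (hs : Av (x :: s))
    (hp : (x :: s).Perm (y :: t)) (hI : I x y (x :: s) = I x y (y :: t)) (hxy : x < y) : False := by
  have hxt : x ∈ t := by
    have : x ∈ y :: t := hp.mem_iff.1 (by simp)
    simpa [hxy.ne] using this
  have h1 : 0 < I x y (y :: t) := by simp [I, hxt]
  rw [← hI] at h1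
  have hx : x ∈ s := by
    by_contra hx
    simp [I, hx] at h1
  obtain ⟨s1, s2, rfl, h2⟩ := exists_last x s hx
  have := I_eq x y hxy.ne (x :: s1) s2 h2
  rw [List.cons_append] at this
  rw [this, List.count_cons_of_ne hxy.ne] at h1
  apply hs x y hxy
  have e1 : [y].Sublist s1 := List.singleton_sublist.2 (List.count_pos_iff.1 h1)
  have e3 : [x].Sublist (x :: s2) := by simp
  simpa using e1.append e3

theorem Av.ext : ∀ {w w' : List (Fin n)}, Av w → Av w' → w.Perm w' →
    (∀ a c, a < c → I a c w = I a c w') → w = w'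
  | [], w', _, _, hp, _ => by simpa using hp
  | x :: s, [], _, _, hp, _ => by simp at hp
  | x :: s, y :: t, hw, hw', hp, hI => by
    have hxy : x = y := by
      rcases lt_trichotomy x y with h | h | h
      · exact (head_aux hw hp (hI _ _ h) h).elim
      · exact h
      · exact (head_aux hw' hp.symm (hI _ _ h).symm h).elim
    subst hxy
    have hp' := hp.cons_inv
    congr 1
    refine Av.ext hw.tail hw'.tail hp' fun a c hac => ?_
    have := hI a c hac
    by_cases ha : a ∈ s
    · have ha' := hp'.mem_iff.1 ha
      simpa [I, ha, ha'] using this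
    · rw [I_eq_zero _ _ _ ha, I_eq_zero _ _ _ (fun h => ha (hp'.mem_iff.2 h))]

/-- number of non-inversions -/
def N : List (Fin n) → ℕ
  | [] => 0
  | x :: t => t.countP (fun y => decide (x < y)) + N t

theorem N_prefix (u t t' : List (Fin n)) (hp : t.Perm t') (h : N t < N t') :
    N (u ++ t) < N (u ++ t') := by
  induction u with
  | nil => simpa using h
  | cons x u ih =>
    simp only [List.cons_append, N]
    rw [(hp.append_left u).countP_eq]
    omega

theorem N_swap (u t : List (Fin n)) (a b : Fin n) (h : a < b) :
    N (u ++ b :: a :: t) < N (u ++ a :: b :: t) := by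
  apply N_prefix _ _ _ (List.Perm.swap _ _ _)
  simp only [N, List.countP_cons, decide_eq_true_eq]
  have := h.not_gt
  simp only [h, this, if_true, if_false]
  simp
  omega

theorem exists_ascent (b c : Fin n) (hbc : b < c) : ∀ (v : List (Fin n)) (h : Fin n), h ≤ b → c ∈ v →
    ∃ v1 p q v2, h :: v = v1 ++ p :: q :: v2 ∧ p ≤ b ∧ b < q := by
  intro v
  induction v with
  | nil => intro h _ hc; simp at hc
  | cons q v ih =>
    intro h hh hc
    by_cases hq : b < q
    · exact ⟨[], h, q, v, rfl, hh, hq⟩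
    · have : c ∈ v := by
        rcases List.mem_cons.1 hc with rfl | hc
        · exact (hq hbc).elim
        · exact hc
      obtain ⟨v1, p, q', v2, e, h1, h2⟩ := ih q (not_lt.1 hq) this
      exact ⟨h :: v1, p, q', v2, by simp [e], h1, h2⟩

theorem sublist_decomp (b c : Fin n) (w : List (Fin n)) (h : [b, c, b].Sublist w) :
    ∃ u v x, w = u ++ b :: v ++ b :: x ∧ c ∈ v := by
  obtain ⟨r1, r2, rfl, h1, h2⟩ := List.cons_sublist_iff.1 h
  obtain ⟨r3, r4, rfl, h3, h4⟩ := List.cons_sublist_iff.1 h2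
  obtain ⟨s, t, rfl⟩ := List.append_of_mem h1
  obtain ⟨s', t', rfl⟩ := List.append_of_mem (List.singleton_sublist.1 h4)
  exact ⟨s, t ++ r3 ++ s', t', by simp, by simp [h3]⟩

theorem exists_step {w : List (Fin n)} (hw : ¬ Av w) : ∃ w', MetaStep w w' ∧ N w' < N w := by
  unfold Av at hw
  push Not at hw
  obtain ⟨b, c, hbc, hs⟩ := hw
  obtain ⟨u, v, x, rfl, hc⟩ := sublist_decomp b c w hs
  obtain ⟨v1, p, q, v2, e, hp, hq⟩ := exists_ascent b c hbc v b le_rfl hc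
  rw [List.append_assoc, List.cons_append, ← List.cons_append, e]
  have hN := N_swap (u ++ v1) (v2 ++ b :: x) p q (hp.trans_lt hq)
  rcases hp.eq_or_lt with rfl | hp
  · refine ⟨(u ++ v1) ++ q :: p :: (v2 ++ p :: x), Or.inl ⟨u ++ v1, v2, x, p, q, hq, by simp, by simp⟩, ?_⟩
    simpa using hN
  · cases v1 with
    | nil =>
      simp only [List.nil_append, List.cons.injEq] at e
      exact (hp.ne e.1.symm).elim
    | cons z v1 =>
      simp only [List.cons_append, List.cons.injEq] at e
      obtain ⟨rfl, -⟩ := e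
      refine ⟨(u ++ b :: v1) ++ q :: p :: (v2 ++ b :: x),
        Or.inr ⟨u, v1, v2, x, p, b, q, hp, hq, by simp, by simp⟩, ?_⟩
      simpa using hN

theorem exists_nf : ∀ (k : ℕ) (w : List (Fin n)), N w ≤ k →
    ∃ w', Av w' ∧ Relation.EqvGen MetaStep w w' := by
  intro k
  induction k with
  | zero =>
    intro w hk
    by_cases hw : Av w
    · exact ⟨w, hw, Relation.EqvGen.refl _⟩
    · obtain ⟨w', _, h⟩ := exists_step hw
      omega
  | succ k ih =>
    intro w hk
    by_cases hw : Av w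
    · exact ⟨w, hw, Relation.EqvGen.refl _⟩
    · obtain ⟨w', hs, h⟩ := exists_step hw
      obtain ⟨w'', h1, h2⟩ := ih w' (by omega)
      exact ⟨w'', h1, (Relation.EqvGen.rel _ _ hs).trans _ _ _ h2⟩

theorem card_classes (m n : ℕ) :
    Nat.card
      (Quotient (Setoid.comap
        (Subtype.val : {w : List (Fin n) // ∀ k, w.count k = m} → List (Fin n))
        (Relation.EqvGen.setoid MetaStep))) =
    Nat.card {w : List (Fin n) // (∀ k, w.count k = m) ∧ Av w} := by
  symm
  refine Nat.card_eq_of_bijective (fun w => Quotient.mk _ ⟨w.1, w.2.1⟩) ⟨?_, ?_⟩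
  · rintro ⟨w, hw, hA⟩ ⟨w', hw', hA'⟩ h
    have h := Quotient.exact h
    have h : Relation.EqvGen MetaStep w w' := h
    have hi := eqv_inv h
    exact Subtype.ext (hA.ext hA' hi.1 fun a c hac => hA.I_eq_of_inv hA' hi _ a c hac le_rfl)
  · intro q
    induction q using Quotient.inductionOn with
    | _ w =>
      obtain ⟨w, hw⟩ := w
      obtain ⟨w', hA, h⟩ := exists_nf _ w le_rfl
      refine ⟨⟨w', fun k => ?_, hA⟩, ?_⟩
      · rw [← (eqv_inv h).1.count_eq, hw]
      · apply Quotient.sound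
        exact h.symm

/-! counting avoiding words -/

def W (m : ℕ) (S : Finset (Fin n)) : Set (List (Fin n)) :=
  {w | (∀ k, w.count k = if k ∈ S then m else 0) ∧ Av w}

theorem W_length {m : ℕ} {S : Finset (Fin n)} {w : List (Fin n)} (h : w ∈ W m S) :
    w.length = m * S.card := by
  have := Multiset.sum_count_eq_card (s := Finset.univ) (m := (w : Multiset (Fin n))) (by simp)
  simp only [Multiset.coe_count, Multiset.coe_card] at this
  rw [← this]
  simp [h.1, mul_comm]

theorem Av_insert {m : ℕ} {a : Fin n} {u v : List (Fin n)} (h : Av (u ++ v))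
    (hu : ∀ x ∈ u, a < x) (hv : ∀ x ∈ v, a < x) :
    Av (u ++ List.replicate m a ++ v) := by
  intro b c hbc hs
  have hf : ∀ l : List (Fin n), (∀ x ∈ l, a < x) → l.filter (fun x => decide (x ≠ a)) = l := by
    intro l hl
    rw [List.filter_eq_self]
    intro x hx
    simpa using (hl x hx).ne'
  by_cases hb : b = a
  · subst hb
    obtain ⟨s, v', x, e, hc⟩ := sublist_decomp b c _ hs
    have hbu : b ∉ u := fun h => lt_irrefl _ (hu b h)
    have hbv : b ∉ v := fun h => lt_irrefl _ (hv b h)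
    -- the part inside
    obtain ⟨r1, r2, e2, h1, h2⟩ := List.cons_sublist_iff.1 hs
    have hs2 : [b, c, b].Sublist (List.replicate m b ++ v) := by
      rw [List.append_assoc] at hs
      obtain ⟨l1, l2, e3, h3, h4⟩ := List.sublist_append_iff.1 hs
      cases l1 with
      | nil => simp only [List.nil_append] at e3; rw [e3]; exact h4
      | cons z l1 =>
        simp only [List.cons_append, List.cons.injEq] at e3
        exact (hbu (e3.1 ▸ h3.subset (by simp))).elim
    obtain ⟨l1, l2, e3, h3, h4⟩ := List.sublist_append_iff.1 hs2
    have hl2 : l2 = [] := by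
      rcases List.eq_nil_or_concat l2 with h | ⟨l, z, h⟩
      · exact h
      · subst h
        rw [List.concat_eq_append, ← List.append_assoc, show [b, c, b] = [b, c] ++ [b] from rfl] at e3
        have := (List.append_inj' e3 rfl).2
        simp only [List.cons.injEq, and_true] at this
        subst this
        exact (hbv (h4.subset (by simp))).elim
    subst hl2
    rw [List.append_nil] at e3
    have : c ∈ List.replicate m b := h3.subset (by rw [← e3]; simp)
    exact hbc.ne' (List.eq_of_mem_replicate this)
  · have hab : c ≠ a := by
      rintro rfl
      have : b ∈ u ++ List.replicate m c ++ v := hs.subset (by simp)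
      simp only [List.mem_append, List.mem_replicate] at this
      rcases this with (h | h) | h
      · exact (hu b h).not_gt hbc
      · exact hb h.2
      · exact (hv b h).not_gt hbc
    have := hs.filter (fun x => decide (x ≠ a))
    rw [List.filter_append, List.filter_append, hf u hu, hf v hv] at this
    simp [hb, hab] at this
    exact h b c hbc this

theorem split_min {a : Fin n} {w : List (Fin n)} (hw : Av w) (hmin : ∀ x ∈ w, a ≤ x) (ha : a ∈ w) :
    ∃ u v k, w = u ++ List.replicate k a ++ v ∧ a ∉ u ∧ a ∉ v := by
  obtain ⟨u, t, rfl, hu⟩ := List.eq_append_cons_of_mem ha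
  obtain ⟨s, v, e, hv⟩ := exists_last a (a :: t) (by simp)
  have hs : ∀ x ∈ s, x = a := by
    intro x hx
    by_contra hne
    have hax : a < x := lt_of_le_of_ne (hmin x (by rw [e]; simp [hx])) (Ne.symm hne)
    apply hw a x hax
    cases s with
    | nil => simp at hx
    | cons z s =>
      simp only [List.cons_append, List.cons.injEq] at e
      obtain ⟨rfl, rfl⟩ := e
      have hx : x ∈ s := by simpa [hne] using hx
      have e1 : [x].Sublist s := List.singleton_sublist.2 hx
      have e3 : [a].Sublist (a :: v) := by simp
      exact (by simpa using e1.append e3 : [a, x, a].Sublist (a :: (s ++ a :: v))).trans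
        (List.sublist_append_right _ _)
  refine ⟨u, v, s.length + 1, ?_, hu, hv⟩
  rw [e, List.replicate_succ', ← List.eq_replicate_of_mem hs]
  simp

theorem card_W (m : ℕ) (hm : 1 ≤ m) (S : Finset (Fin n)) :
    Nat.card (W m S) = ∏ k ∈ Finset.range S.card, (1 + m * k) := by
  induction S using Finset.induction_on_min with
  | empty =>
    have : W m (∅ : Finset (Fin n)) = {[]} := by
      ext w
      simp only [Set.mem_singleton_iff]
      constructor
      · intro h
        have := W_length h
        simpa using this
      · rintro rfl
        exact ⟨by simp, fun a b _ h => by simp at h⟩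
    rw [this]
    simp
  | insert a S hS ih =>
    have haS : a ∉ S := fun h => lt_irrefl _ (hS a h)
    have hmem : ∀ w ∈ W m S, ∀ x ∈ w, a < x := by
      intro w hw x hx
      apply hS
      by_contra h
      have := hw.1 x
      rw [if_neg h] at this
      exact List.count_eq_zero.1 this hx
    rw [Finset.card_insert_of_notMem haS, Finset.prod_range_succ, ← ih,
      ← Nat.card_fin (1 + m * S.card), ← Nat.card_prod]
    symm
    refine Nat.card_eq_of_bijective (fun wp : W m S × Fin (1 + m * S.card) =>
      (⟨wp.1.1.take wp.2 ++ List.replicate m a ++ wp.1.1.drop wp.2, ?_, ?_⟩ : W m (insert a S))) ⟨?_, ?_⟩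
    · intro k
      have h1 := wp.1.2.1 k
      rw [← List.take_append_drop wp.2 wp.1.1, List.count_append] at h1
      rw [List.count_append, List.count_append, List.count_replicate]
      by_cases hk : k = a
      · subst hk
        simp [haS] at h1 ⊢
        omega
      · have hk' : a ≠ k := fun h => hk h.symm
        simp [hk, hk'] at h1 ⊢
        omega
    · apply Av_insert
      · rw [List.take_append_drop]; exact wp.1.2.2
      · intro x hx; exact hmem _ wp.1.2 _ (List.mem_of_mem_take hx)
      · intro x hx; exact hmem _ wp.1.2 _ (List.mem_of_mem_drop hx)
    · rintro ⟨⟨w, hw⟩, p⟩ ⟨⟨w', hw'⟩, p'⟩ h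
      have h : w.take p ++ List.replicate m a ++ w.drop p =
        w'.take p' ++ List.replicate m a ++ w'.drop p' := congrArg Subtype.val h
      have key : ∀ (w : List (Fin n)) (hw : w ∈ W m S) (p : Fin (1 + m * S.card)),
          (w.take p ++ List.replicate m a ++ w.drop p).filter (fun x => decide (x ≠ a)) = w ∧
          (w.take p ++ List.replicate m a ++ w.drop p).idxOf a = p := by
        intro w hw p
        have hpl : (p : ℕ) ≤ w.length := by rw [W_length hw]; omega
        have hat : a ∉ w.take p := fun h => lt_irrefl _ (hmem w hw a (List.mem_of_mem_take h))
        constructor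
        · have hf : ∀ l : List (Fin n), (∀ x ∈ l, a < x) → l.filter (fun x => decide (x ≠ a)) = l := by
            intro l hl
            rw [List.filter_eq_self]
            intro x hx
            simpa using (hl x hx).ne'
          rw [List.filter_append, List.filter_append, hf (w.take p) (fun x hx => hmem _ hw _ (List.mem_of_mem_take hx)),
            hf (w.drop p) (fun x hx => hmem _ hw _ (List.mem_of_mem_drop hx))]
          simp
        · obtain ⟨m, rfl⟩ : ∃ m', m = m' + 1 := ⟨m - 1, by omega⟩
          rw [List.append_assoc, List.idxOf_append_of_notMem hat, List.replicate_succ,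
            List.cons_append, List.idxOf_cons_self, List.length_take]
          omega
      have e1 := key w hw p
      have e2 := key w' hw' p'
      rw [h] at e1
      have e3 : w = w' := e1.1.symm.trans e2.1
      have e4 : p = p' := Fin.ext (e1.2.symm.trans e2.2)
      subst e3 e4
      rfl
    · rintro ⟨w, hw⟩
      have hmin : ∀ x ∈ w, a ≤ x := by
        intro x hx
        by_contra h
        have h0 := hw.1 x
        have : x ∉ insert a S := by
          rw [Finset.mem_insert, not_or]
          exact ⟨fun e => h e.ge, fun e => h (hS x e).le⟩
        rw [if_neg this] at h0
        exact List.count_eq_zero.1 h0 hx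
      have hca := hw.1 a
      rw [if_pos (Finset.mem_insert_self _ _)] at hca
      obtain ⟨u, v, k, rfl, hu, hv⟩ := split_min hw.2 hmin (List.count_pos_iff.1 (by omega))
      have hkm : k = m := by
        rw [List.count_append, List.count_append, List.count_replicate_self,
          List.count_eq_zero_of_not_mem hu, List.count_eq_zero_of_not_mem hv] at hca
        omega
      subst hkm
      have hW : u ++ v ∈ W k S := by
        refine ⟨fun x => ?_, fun b c hbc hs => hw.2 b c hbc (hs.trans ?_)⟩
        · have := hw.1 x
          rw [List.count_append, List.count_append, List.count_replicate] at this
          rw [List.count_append]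
          by_cases hx : x = a
          · subst hx
            rw [if_neg haS, List.count_eq_zero_of_not_mem hu, List.count_eq_zero_of_not_mem hv]
          · have hx' : a ≠ x := fun h => hx h.symm
            simp [hx, hx'] at this ⊢
            exact this
        · rw [List.append_assoc]
          exact (List.Sublist.refl u).append (List.sublist_append_right _ _)
      have hl := W_length hW
      rw [List.length_append] at hl
      refine ⟨⟨⟨u ++ v, hW⟩, ⟨u.length, by omega⟩⟩, ?_⟩
      apply Subtype.ext
      simp

theorem card_nf (m n : ℕ) (hm : 1 ≤ m) :
    Nat.card {w : List (Fin n) // (∀ k, w.count k = m) ∧ Av w} = ∏ k ∈ Finset.range n, (1 + m * k) := by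
  have := card_W (n := n) m hm Finset.univ
  rw [Finset.card_univ, Fintype.card_fin] at this
  rw [← this]
  apply Nat.card_congr
  apply Equiv.subtypeEquivRight
  intro w
  simp [W]

/-! counting trees -/

variable {m : ℕ}

def Lv : MTree m → Type
  | .leaf => Unit
  | .node _ ts => Σ i, Lv (ts i)

def ins (l : ℕ) : (T : MTree m) → Lv T → MTree m
  | .leaf, _ => .node l (fun _ => .leaf)
  | .node r ts, p => .node r (Function.update ts p.1 (ins l (ts p.1) p.2))

def rem (l : ℕ) : MTree m → MTree m
  | .leaf => .leaf
  | .node r ts => if r = l then .leaf else .node r (fun i => rem l (ts i))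

theorem Lv_finite (T : MTree m) : Finite (Lv T) := by
  induction T with
  | leaf => exact inferInstanceAs (Finite Unit)
  | node r ts ih => exact inferInstanceAs (Finite (Σ i, Lv (ts i)))

theorem Lv_card (T : MTree m) : Nat.card (Lv T) = 1 + m * Multiset.card T.labels := by
  induction T with
  | leaf => simp [Lv, MTree.labels]
  | node r ts ih =>
    have := fun i => Lv_finite (ts i)
    change Nat.card (Σ i, Lv (ts i)) = _
    rw [Nat.card_sigma]
    simp only [ih, MTree.labels, Multiset.card_cons, Multiset.card_sum, Finset.sum_add_distrib,
      ← Finset.mul_sum]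
    simp
    ring

theorem labels_ins (l : ℕ) (T : MTree m) (p : Lv T) : (ins l T p).labels = l ::ₘ T.labels := by
  induction T with
  | leaf => simp [ins, MTree.labels]
  | node r ts ih =>
    obtain ⟨i, p⟩ := p
    simp only [ins, MTree.labels]
    rw [Multiset.cons_swap]
    congr 1
    rw [← Finset.add_sum_erase _ _ (Finset.mem_univ i), ← Finset.add_sum_erase (a := i) _ (fun i => (ts i).labels) (Finset.mem_univ i),
      Function.update_self, ih, Multiset.cons_add]
    congr 2
    apply Finset.sum_congr rfl
    intro j hj
    rw [Function.update_of_ne (Finset.ne_of_mem_erase hj)]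

theorem mem_labels_node {r : ℕ} {ts : Fin (m + 1) → MTree m} {x : ℕ} :
    x ∈ (MTree.node r ts).labels ↔ x = r ∨ ∃ i, x ∈ (ts i).labels := by
  simp [MTree.labels, Multiset.mem_sum]

theorem rem_of_notMem (l : ℕ) (T : MTree m) (h : l ∉ T.labels) : rem l T = T := by
  induction T with
  | leaf => rfl
  | node r ts ih =>
    rw [mem_labels_node, not_or, not_exists] at h
    simp only [rem, if_neg (Ne.symm h.1)]
    congr 1
    funext i
    exact ih i (h.2 i)

theorem rem_ins (l : ℕ) (T : MTree m) (p : Lv T) (h : l ∉ T.labels) : rem l (ins l T p) = T := by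
  induction T with
  | leaf => simp [ins, rem]
  | node r ts ih =>
    obtain ⟨i, p⟩ := p
    rw [mem_labels_node, not_or, not_exists] at h
    simp only [ins, rem, if_neg (Ne.symm h.1)]
    congr 1
    funext j
    by_cases hj : j = i
    · subst hj
      rw [Function.update_self, ih _ _ (h.2 j)]
    · rw [Function.update_of_ne hj, rem_of_notMem _ _ (h.2 j)]

theorem ins_inj (l : ℕ) (T : MTree m) : Function.Injective (ins l T) := by
  induction T with
  | leaf => intro p q _; exact Subsingleton.elim (α := Unit) p q
  | node r ts ih =>
    rintro ⟨i, p⟩ ⟨j, q⟩ h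
    simp only [ins, MTree.node.injEq, true_and] at h
    have hij : i = j := by
      by_contra hij
      have h1 := congrFun h i
      rw [Function.update_self, Function.update_of_ne hij] at h1
      have := congrArg (fun T => Multiset.card T.labels) h1
      simp [labels_ins] at this
    subst hij
    have h1 := congrFun h i
    rw [Function.update_self, Function.update_self] at h1
    rw [ih i h1]

theorem dec_ins (l : ℕ) (T : MTree m) (p : Lv T) (hl : ∀ x ∈ T.labels, l < x) (h : T.Decreasing) :
    (ins l T p).Decreasing := by
  induction T with
  | leaf => simp [ins, MTree.Decreasing, MTree.labels]
  | node r ts ih =>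
    obtain ⟨i, p⟩ := p
    simp only [ins, MTree.Decreasing] at h ⊢
    intro j
    by_cases hj : j = i
    · subst hj
      rw [Function.update_self, labels_ins]
      refine ⟨?_, ih j p (fun x hx => hl x (mem_labels_node.2 (Or.inr ⟨j, hx⟩))) (h j).2⟩
      intro x hx
      rcases Multiset.mem_cons.1 hx with rfl | hx
      · exact hl r (mem_labels_node.2 (Or.inl rfl))
      · exact (h j).1 x hx
    · rw [Function.update_of_ne hj]; exact h j

theorem dec_of_ins (l : ℕ) (T : MTree m) (p : Lv T) (h : (ins l T p).Decreasing) :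
    T.Decreasing := by
  induction T with
  | leaf => trivial
  | node r ts ih =>
    obtain ⟨i, p⟩ := p
    simp only [ins, MTree.Decreasing] at h ⊢
    intro j
    have hj' := h j
    by_cases hj : j = i
    · subst hj
      rw [Function.update_self, labels_ins] at hj'
      exact ⟨fun x hx => hj'.1 x (Multiset.mem_cons_of_mem hx), ih j p hj'.2⟩
    · rwa [Function.update_of_ne hj] at hj'

theorem exists_ins (l : ℕ) (T : MTree m) (h : T.Decreasing) (hl : l ∈ T.labels)
    (hmin : ∀ x ∈ T.labels, l ≤ x) : ∃ (T' : MTree m) (p : Lv T'), ins l T' p = T := by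
  induction T with
  | leaf => simp [MTree.labels] at hl
  | node r ts ih =>
    by_cases hr : l = r
    · subst hr
      refine ⟨.leaf, (), ?_⟩
      simp only [ins]
      congr 1
      funext i
      cases hti : ts i with
      | leaf => rfl
      | node s us =>
        have hs : s ∈ (ts i).labels := by rw [hti]; exact mem_labels_node.2 (Or.inl rfl)
        exact absurd (hmin s (mem_labels_node.2 (Or.inr ⟨i, hs⟩))) (not_le.2 ((h i).1 s hs))
    · obtain ⟨i, hi⟩ := (mem_labels_node.1 hl).resolve_left hr
      obtain ⟨T', p, e⟩ := ih i (h i).2 hi (fun x hx => hmin x (mem_labels_node.2 (Or.inr ⟨i, hx⟩)))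
      have hu : Function.update ts i T' i = T' := Function.update_self ..
      obtain ⟨p', e'⟩ : ∃ p' : Lv (Function.update ts i T' i), ins l _ p' = ts i := by
        rw [hu]; exact ⟨p, e⟩
      refine ⟨.node r (Function.update ts i T'), ⟨i, p'⟩, ?_⟩
      simp only [ins]
      rw [e']
      simp

def D (m : ℕ) (S : Finset ℕ) : Set (MTree m) := {T | T.labels = S.val ∧ T.Decreasing}

theorem card_D (m : ℕ) (S : Finset ℕ) :
    Nat.card (D m S) = ∏ k ∈ Finset.range S.card, (1 + m * k) := by
  induction S using Finset.induction_on_min with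
  | empty =>
    have : D m (∅ : Finset ℕ) = {.leaf} := by
      ext T
      simp only [D, Set.mem_ofPred_eq, Set.mem_singleton_iff]
      constructor
      · rintro ⟨h, -⟩
        cases T with
        | leaf => rfl
        | node r ts => simp [MTree.labels] at h
      · rintro rfl
        exact ⟨rfl, trivial⟩
    rw [this]
    simp
  | insert a S hS ih =>
    have haS : a ∉ S := fun h => lt_irrefl _ (hS a h)
    rw [Finset.card_insert_of_notMem haS, Finset.prod_range_succ, ← ih,
      ← Nat.card_fin (1 + m * S.card), ← Nat.card_prod]
    have e : ∀ T : D m S, Nonempty (Lv T.1 ≃ Fin (1 + m * S.card)) := by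
      intro T
      have := Lv_finite T.1
      refine ⟨Finite.equivFinOfCardEq ?_⟩
      rw [Lv_card, T.2.1]; rfl
    rw [← Nat.card_congr ((Equiv.sigmaCongrRight fun T => (e T).some).trans (Equiv.sigmaEquivProd _ _))]
    symm
    have hval : (insert a S).val = a ::ₘ S.val := Finset.insert_val_of_notMem haS
    refine Nat.card_eq_of_bijective (fun Tp : Σ T : D m S, Lv T.1 =>
      (⟨ins a Tp.1.1 Tp.2, ?_, ?_⟩ : D m (insert a S))) ⟨?_, ?_⟩
    · rw [labels_ins, Tp.1.2.1, hval]
    · apply dec_ins _ _ _ _ Tp.1.2.2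
      rw [Tp.1.2.1]; exact hS
    · rintro ⟨⟨T, hT⟩, p⟩ ⟨⟨T', hT'⟩, p'⟩ h
      have h : ins a T p = ins a T' p' := congrArg Subtype.val h
      have h1 := rem_ins a T p (by rw [hT.1]; exact haS)
      have h2 := rem_ins a T' p' (by rw [hT'.1]; exact haS)
      have : T = T' := by rw [← h1, ← h2, h]
      subst this
      rw [ins_inj a T h]
    · rintro ⟨T, hT⟩
      obtain ⟨T', p, e⟩ := exists_ins a T hT.2 (by rw [hT.1, hval]; simp) (by
        intro x hx
        rw [hT.1, hval] at hx
        rcases Multiset.mem_cons.1 hx with rfl | hx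
        · exact le_rfl
        · exact (hS x hx).le)
      subst e
      have h1 := hT.1
      rw [labels_ins, hval, Multiset.cons_inj_right] at h1
      exact ⟨⟨⟨T', h1, dec_of_ins _ _ _ hT.2⟩, p⟩, rfl⟩

theorem card_trees (m n : ℕ) :
    Nat.card {T : MTree m // T.labels = (Multiset.range n).map (· + 1) ∧ T.Decreasing} =
      ∏ k ∈ Finset.range n, (1 + m * k) := by
  have := card_D m ((Finset.range n).map (addRightEmbedding 1))
  rw [Finset.card_map, Finset.card_range] at this
  exact this

theorem prod_eq (m n : ℕ) : ∏ k ∈ Finset.range n, (1 + m * k) = ∏ k ∈ Finset.Ico 1 n, (1 + m * k) := by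
  cases n with
  | zero => simp
  | succ n => rw [Finset.range_eq_Ico, Finset.prod_eq_prod_Ico_succ_bot (by omega)]; simp

end MS

/-- The number of metasylvester classes of `m`-permutations of `n`
(words of evaluation `(m,…,m)`) equals the number of decreasing `(m+1)`-ary trees on
`n` nodes labeled bijectively by `1,…,n`, and this common count is
`∏_{k=1}^{n-1} (1 + mk)`. -/
theorem card_metasylvester_classes_eq_card_decreasingTrees (m n : ℕ) (hm : 1 ≤ m) :
    Nat.card
      (Quotient (Setoid.comap
        (Subtype.val : {w : List (Fin n) // ∀ k, w.count k = m} → List (Fin n))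
        (Relation.EqvGen.setoid MetaStep))) =
      Nat.card {T : MTree m //
        T.labels = (Multiset.range n).map (· + 1) ∧ T.Decreasing} ∧
    Nat.card {T : MTree m //
        T.labels = (Multiset.range n).map (· + 1) ∧ T.Decreasing} =
      ∏ k ∈ Finset.Ico 1 n, (1 + m * k) := by
  rw [MS.card_classes, MS.card_nf m n hm, MS.card_trees, MS.prod_eq]
  exact ⟨rfl, rfl⟩
end
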